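/- Suppose g is not of type A_{2p}, and let g = g₀ ⊕ g₁ be the Z₂-grading associated with the involution σ_K, where g₀ = t ⊕ (⊕_{γ(x_K) even} g_γ) and g₁ = ⊕_{γ(x_K) odd} g_γ. Then the (−1)-eigenspace g₁ contains a regular semisimple element of g and a regular nilpotent element of g. -/

import Mathlib

open scoped RealInnerProductSpace

attribute [local instance] Classical.propDecidable

section RootCombinatorics

variable {V : Type*} [NormedAddCommGroup V] [InnerProductSpace ℝ V]

/-- The Cartan pairing `⟨γ, α∨⟩ = 2 (γ, α) / (α, α)`. -/
noncomputable def cartanPairing (γ α : V) : ℝ := 2 * ⟪γ, α⟫ / ⟪α, α⟫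

/-- The coroot `γ∨ = 2 γ / (γ, γ)`. -/
noncomputable def covec (γ : V) : V := (2 / ⟪γ, γ⟫) • γ

/-- The cascade element `x_K = Σ_{β ∈ K} β / (β, β) = ½ Σ_{β ∈ K} β∨`. -/
noncomputable def cascElt (K : Finset V) : V := ∑ β ∈ K, (⟪β, β⟫)⁻¹ • β

/-- The roots of `S` orthogonal to `β`. -/
noncomputable def orthSub (S : Finset V) (β : V) : Finset V := S.filter fun γ => ⟪γ, β⟫ = 0

/-- One step of the non-orthogonality (connectedness) relation inside `S`. -/
def connRel (S : Finset V) (a b : V) : Prop := a ∈ S ∧ b ∈ S ∧ ⟪a, b⟫ ≠ 0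

/-- The irreducible component of the root subsystem `S` containing `γ`. -/
noncomputable def component (S : Finset V) (γ : V) : Finset V :=
  S.filter fun γ' => Relation.ReflTransGen (connRel S) γ γ'

/-- `C` is an irreducible component of the root subsystem `S`. -/
def IsComponent (S C : Finset V) : Prop := ∃ γ ∈ S, C = component S γ

end RootCombinatorics

/-- The combinatorial data of an irreducible crystallographic root system with a chosen
system of positive roots, base (set of simple roots) and highest root: the combinatorial
skeleton of a finite-dimensional complex simple Lie algebra, with the Killing-form
identification of the Cartan subalgebra and its dual. -/
structure RootSystemCtx (V : Type*) [NormedAddCommGroup V] [InnerProductSpace ℝ V] where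
  /-- the set of roots Δ -/
  Δ : Finset V
  /-- the set of simple roots Π -/
  base : Finset V
  /-- the set of positive roots Δ⁺ -/
  Pos : Finset V
  /-- the highest root θ -/
  θ : V
  zero_not_mem : (0 : V) ∉ Δ
  neg_mem : ∀ γ ∈ Δ, -γ ∈ Δ
  reflect_mem : ∀ α ∈ Δ, ∀ γ ∈ Δ, γ - cartanPairing γ α • α ∈ Δ
  pairing_int : ∀ α ∈ Δ, ∀ γ ∈ Δ, ∃ k : ℤ, cartanPairing γ α = (k : ℝ)
  span_eq : Submodule.span ℝ (Δ : Set V) = ⊤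
  base_subset : base ⊆ Pos
  base_indep : LinearIndependent ℝ (fun a : {x // x ∈ base} => (a : V))
  pos_subset : Pos ⊆ Δ
  pos_or_neg : ∀ γ ∈ Δ, γ ∈ Pos ∨ -γ ∈ Pos
  pos_not_neg : ∀ γ ∈ Pos, -γ ∉ Pos
  pos_coords : ∀ γ ∈ Pos, γ ∈ AddSubmonoid.closure (base : Set V)
  irreducible : ∀ S : Finset V, S ⊆ Δ → S.Nonempty →
    (∀ a ∈ S, ∀ b ∈ Δ, b ∉ S → ⟪a, b⟫ = 0) → S = Δ
  theta_mem : θ ∈ Pos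
  theta_highest : ∀ γ ∈ Δ, θ - γ ∈ AddSubmonoid.closure (base : Set V)

namespace RootSystemCtx

variable {V : Type*} [NormedAddCommGroup V] [InnerProductSpace ℝ V]

variable (ctx : RootSystemCtx V)

/-- The root order `γ ≼ γ'` on roots: `γ' - γ` is a nonnegative integral combination of
simple roots. -/
def rootLE (γ γ' : V) : Prop := γ' - γ ∈ AddSubmonoid.closure (ctx.base : Set V)

/-- `β` is the highest root of the root subsystem `S` (with respect to the ambient positive
system). -/
def IsHighest (S : Finset V) (β : V) : Prop :=
  β ∈ S ∧ β ∈ ctx.Pos ∧ ∀ γ ∈ S, ctx.rootLE γ β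

/-- `CascadeMem ctx S β` : the pair (root subsystem `S = Δ⟨i⟩`, its highest root `β = βᵢ`)
occurs in the recursive construction of the Kostant cascade: one starts with `(Δ, θ)`, and the
descendants of `(S, β)` are the pairs `(C, β')` where `C` is an irreducible component of
`{γ ∈ S | (γ, β) = 0}` and `β'` is the highest root of `C`. -/
inductive CascadeMem : Finset V → V → Prop
  | top : CascadeMem ctx.Δ ctx.θ
  | step {S C : Finset V} {β β' : V} : CascadeMem S β →
      IsComponent (orthSub S β) C → ctx.IsHighest C β' → CascadeMem C β'

/-- `K` is the Kostant cascade of the root system. -/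
def IsCascade (K : Finset V) : Prop := ∀ β, β ∈ K ↔ ∃ S, ctx.CascadeMem S β

/-- The Heisenberg subset `H_β = {γ ∈ S ∩ Δ⁺ : (γ, β) > 0}` attached to a cascade pair
`(S, β)`. -/
noncomputable def heis (S : Finset V) (β : V) : Finset V :=
  S.filter fun γ => γ ∈ ctx.Pos ∧ 0 < ⟪γ, β⟫

/-- A root is long if it has the same length as the highest root. -/
def IsLong (γ : V) : Prop := ⟪γ, γ⟫ = ⟪ctx.θ, ctx.θ⟫

/-- The highest root `θ` is a fundamental weight. -/
def ThetaFundamental : Prop :=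
  ∃ α ∈ ctx.base, cartanPairing ctx.θ α = 1 ∧
    ∀ β ∈ ctx.base, β ≠ α → cartanPairing ctx.θ β = 0

/-- `β'` is a descendant of the cascade element `β`. -/
def Desc (β β' : V) : Prop :=
  ∃ S C, ctx.CascadeMem S β ∧ IsComponent (orthSub S β) C ∧ ctx.IsHighest C β'

/-- The cascade poset order: `β ≤ β'` iff `β` is an iterated descendant of `β'`. -/
def cascLE (β β' : V) : Prop := Relation.ReflTransGen (fun a b => ctx.Desc b a) β β'

/-- A simple reflection of the root system. -/
def IsSimpleReflection (w : V ≃ₗ[ℝ] V) : Prop :=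
  ∃ α ∈ ctx.base, ∀ v, w v = v - (2 * ⟪v, α⟫ / ⟪α, α⟫) • α

/-- The Weyl group, generated by the simple reflections. -/
def weylGroup : Subgroup (V ≃ₗ[ℝ] V) := Subgroup.closure {w | ctx.IsSimpleReflection w}

/-- The length of a Weyl group element: the minimal number of simple reflections needed to
express it. -/
noncomputable def length (w : V ≃ₗ[ℝ] V) : ℕ :=
  sInf {n | ∃ l : List (V ≃ₗ[ℝ] V), l.length = n ∧
    (∀ s ∈ l, ctx.IsSimpleReflection s) ∧ l.prod = w}

/-- The root system is of type `Aₙ` (Cartan matrix characterisation). -/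
def IsTypeA (n : ℕ) : Prop :=
  1 ≤ n ∧ ∃ e : Fin n ≃ {x // x ∈ ctx.base}, ∀ i j : Fin n,
    cartanPairing (e i : V) (e j : V) =
      (if i = j then 2 else if i.val + 1 = j.val ∨ j.val + 1 = i.val then -1 else 0)

/-- The root system is of type `Bₙ` (`n ≥ 2`), with the last simple root short. -/
def IsTypeB (n : ℕ) : Prop :=
  2 ≤ n ∧ ∃ e : Fin n ≃ {x // x ∈ ctx.base}, ∀ i j : Fin n,
    cartanPairing (e i : V) (e j : V) =
      (if i = j then 2
       else if i.val + 2 = n ∧ j.val + 1 = n then -2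
       else if i.val + 1 = j.val ∨ j.val + 1 = i.val then -1 else 0)

/-- The root system is of type `Cₙ` (`n ≥ 2`), with the last simple root long. -/
def IsTypeC (n : ℕ) : Prop :=
  2 ≤ n ∧ ∃ e : Fin n ≃ {x // x ∈ ctx.base}, ∀ i j : Fin n,
    cartanPairing (e i : V) (e j : V) =
      (if i = j then 2
       else if i.val + 1 = n ∧ j.val + 2 = n then -2
       else if i.val + 1 = j.val ∨ j.val + 1 = i.val then -1 else 0)

/-- The root system is of type `G₂` (first simple root short). -/
def IsTypeG2 : Prop :=
  ∃ e : Fin 2 ≃ {x // x ∈ ctx.base},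
    cartanPairing (e 0 : V) (e 0 : V) = 2 ∧ cartanPairing (e 1 : V) (e 1 : V) = 2 ∧
    cartanPairing (e 0 : V) (e 1 : V) = -1 ∧ cartanPairing (e 1 : V) (e 0 : V) = -3

/-- The set of roots `Δ(a_z) = w(Δ⁺_z(-1)) ∪ w(-Δ⁺_z(2))` of the abelian ideal attached by
Kostant's construction to `z` (with `w = w_z`). -/
def idealSet (w : V ≃ₗ[ℝ] V) (x : V) : Set V :=
  {δ | ∃ γ ∈ ctx.Pos, (⟪γ, x⟫ = -1 ∧ δ = w γ) ∨ (⟪γ, x⟫ = 2 ∧ δ = -(w γ))}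

end RootSystemCtx

/-- A root-space decomposition of a finite-dimensional complex Lie algebra `g` compatible
with the root-system data `ctx`: a Cartan subalgebra `t`, root vectors `e γ` for `γ ∈ Δ`,
and the Killing identification `coh : V → t` of the rational/real form of the Cartan
subalgebra with the Euclidean space `V` carrying the root system. -/
structure LieRootData {V : Type*} [NormedAddCommGroup V] [InnerProductSpace ℝ V]
    (ctx : RootSystemCtx V) (g : Type*) [LieRing g] [LieAlgebra ℂ g] where
  t : LieSubalgebra ℂ g
  e : V → g
  coh : V → g
  coh_add : ∀ v w, coh (v + w) = coh v + coh w
  coh_smul : ∀ (r : ℝ) (v : V), coh (r • v) = (r : ℂ) • coh v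
  coh_inj : ∀ v, coh v = 0 → v = 0
  coh_mem : ∀ v, coh v ∈ t
  t_span : t.toSubmodule = Submodule.span ℂ (Set.range coh)
  t_abelian : ∀ x ∈ t, ∀ y ∈ t, ⁅x, y⁆ = (0 : g)
  e_ne : ∀ γ ∈ ctx.Δ, e γ ≠ 0
  bracket_coh_e : ∀ (v : V), ∀ γ ∈ ctx.Δ, ⁅coh v, e γ⁆ = (⟪γ, v⟫ : ℂ) • e γ
  bracket_e_e_root : ∀ γ ∈ ctx.Δ, ∀ δ ∈ ctx.Δ, γ + δ ∈ ctx.Δ →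
    ∃ c : ℂ, c ≠ 0 ∧ ⁅e γ, e δ⁆ = c • e (γ + δ)
  bracket_e_e_neg : ∀ γ ∈ ctx.Δ, ∃ c : ℂ, c ≠ 0 ∧ ⁅e γ, e (-γ)⁆ = c • coh γ
  bracket_e_e_zero : ∀ γ ∈ ctx.Δ, ∀ δ ∈ ctx.Δ, γ + δ ∉ ctx.Δ → γ + δ ≠ 0 → ⁅e γ, e δ⁆ = 0
  span_top : (⊤ : Submodule ℂ g) = t.toSubmodule ⊔ Submodule.span ℂ (e '' (ctx.Δ : Set V))
  dim_eq : Module.finrank ℂ g = Module.finrank ℂ ↥t + ctx.Δ.card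
  rank_eq : Module.finrank ℂ ↥t = ctx.base.card

namespace RootSystemCtx

section Base

variable {V : Type*} [NormedAddCommGroup V] [InnerProductSpace ℝ V] (ctx : RootSystemCtx V)

lemma ne_zero_of_mem {γ : V} (h : γ ∈ ctx.Δ) : γ ≠ 0 := fun h0 => ctx.zero_not_mem (h0 ▸ h)

lemma inner_self_pos {γ : V} (h : γ ∈ ctx.Δ) : 0 < ⟪γ, γ⟫ :=
  real_inner_self_pos.2 (ctx.ne_zero_of_mem h)

lemma base_mem {α : V} (h : α ∈ ctx.base) : α ∈ ctx.Δ := ctx.pos_subset (ctx.base_subset h)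

lemma span_base : Submodule.span ℝ (ctx.base : Set V) = ⊤ := by
  have hcl : ∀ v ∈ AddSubmonoid.closure (ctx.base : Set V),
      v ∈ Submodule.span ℝ (ctx.base : Set V) := fun v hv =>
    (AddSubmonoid.closure_le (S := (Submodule.span ℝ (ctx.base : Set V)).toAddSubmonoid)).2
      Submodule.subset_span hv
  rw [eq_top_iff, ← ctx.span_eq, Submodule.span_le]
  intro γ hγ
  rcases ctx.pos_or_neg γ hγ with h | h
  · exact hcl _ (ctx.pos_coords _ h)
  · simpa using Submodule.neg_mem _ (hcl _ (ctx.pos_coords _ h))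

/-- Any prescribed values on the simple roots are realised by a vector. -/
lemma exists_inner_eq [FiniteDimensional ℝ V] (f : V → ℝ) :
    ∃ v : V, ∀ b ∈ ctx.base, ⟪b, v⟫ = f b := by
  let B := Module.Basis.mk ctx.base_indep (by
    rw [← ctx.span_base]
    exact Submodule.span_mono fun x hx => ⟨⟨x, hx⟩, rfl⟩)
  let φ : V →ₗ[ℝ] ℝ := B.constr ℝ fun b => f b
  refine ⟨(InnerProductSpace.toDual ℝ V).symm φ.toContinuousLinearMap, fun b hb => ?_⟩
  rw [real_inner_comm, InnerProductSpace.toDual_symm_apply]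
  have h : φ (B ⟨b, hb⟩) = f b :=
    B.constr_basis ℝ (fun b : {x // x ∈ ctx.base} => f b) ⟨b, hb⟩
  rwa [Module.Basis.mk_apply] at h

lemma inner_nonneg_of_mem_closure {w : V} (hw : ∀ b ∈ ctx.base, 0 ≤ ⟪b, w⟫) {v : V}
    (hv : v ∈ AddSubmonoid.closure (ctx.base : Set V)) : 0 ≤ ⟪v, w⟫ := by
  induction hv using AddSubmonoid.closure_induction with
  | mem x hx => exact hw x hx
  | zero => simp
  | add x y _ _ hx hy => rw [inner_add_left]; exact add_nonneg hx hy

lemma closure_zero_or {v : V} (hv : v ∈ AddSubmonoid.closure (ctx.base : Set V)) :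
    v = 0 ∨ ∃ b ∈ ctx.base, ∃ v' ∈ AddSubmonoid.closure (ctx.base : Set V), v = b + v' := by
  induction hv using AddSubmonoid.closure_induction with
  | mem x hx => exact Or.inr ⟨x, hx, 0, zero_mem _, (add_zero x).symm⟩
  | zero => exact Or.inl rfl
  | add x y hx hy ihx ihy =>
    rcases ihx with rfl | ⟨b, hb, v', hv', rfl⟩
    · simpa using ihy
    · exact Or.inr ⟨b, hb, v' + y, add_mem hv' hy, add_assoc _ _ _⟩

lemma mem_closure_or {γ : V} (h : γ ∈ ctx.Δ) :
    γ ∈ AddSubmonoid.closure (ctx.base : Set V) ∨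
      -γ ∈ AddSubmonoid.closure (ctx.base : Set V) :=
  (ctx.pos_or_neg γ h).imp (ctx.pos_coords γ) (ctx.pos_coords (-γ))

lemma pairing_symm_reflect {α γ : V} (hα : α ∈ ctx.Δ) (hγ : γ ∈ ctx.Δ) {k : ℤ}
    (hk : cartanPairing γ α = k) : γ - (k : ℝ) • α ∈ ctx.Δ := hk ▸ ctx.reflect_mem α hα γ hγ

lemma pairing_mul_self {α γ : V} (hα : α ∈ ctx.Δ) :
    cartanPairing γ α * ⟪α, α⟫ = 2 * ⟪γ, α⟫ := by
  unfold cartanPairing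
  exact div_mul_cancel₀ _ (ctx.inner_self_pos hα).ne'

variable [FiniteDimensional ℝ V]

/-- The sum of the fundamental coweights: it pairs to `1` with every simple root. -/
noncomputable def rho : V := Classical.choose (ctx.exists_inner_eq fun _ => 1)

lemma inner_rho {b : V} (hb : b ∈ ctx.base) : ⟪b, ctx.rho⟫ = 1 :=
  Classical.choose_spec (ctx.exists_inner_eq fun _ => 1) b hb

/-- The fundamental coweight attached to a simple root. -/
noncomputable def fund (a : V) : V :=
  Classical.choose (ctx.exists_inner_eq fun b => if b = a then 1 else 0)

lemma inner_fund_self {a : V} (ha : a ∈ ctx.base) : ⟪a, ctx.fund a⟫ = 1 :=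
  (Classical.choose_spec (ctx.exists_inner_eq fun b => if b = a then 1 else 0) a ha).trans
    (if_pos rfl)

lemma inner_fund_ne {a b : V} (hb : b ∈ ctx.base) (h : b ≠ a) : ⟪b, ctx.fund a⟫ = 0 :=
  (Classical.choose_spec (ctx.exists_inner_eq fun b => if b = a then 1 else 0) b hb).trans
    (if_neg h)

lemma inner_fund_nonneg {a v : V} (ha : a ∈ ctx.base)
    (hv : v ∈ AddSubmonoid.closure (ctx.base : Set V)) : 0 ≤ ⟪v, ctx.fund a⟫ := by
  refine ctx.inner_nonneg_of_mem_closure (fun b hb => ?_) hv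
  by_cases h : b = a
  · subst h; rw [ctx.inner_fund_self hb]; norm_num
  · rw [ctx.inner_fund_ne hb h]

lemma inner_rho_nonneg {v : V} (hv : v ∈ AddSubmonoid.closure (ctx.base : Set V)) :
    0 ≤ ⟪v, ctx.rho⟫ :=
  ctx.inner_nonneg_of_mem_closure (fun b hb => by rw [ctx.inner_rho hb]; norm_num) hv

lemma eq_zero_of_inner_rho_lt {v : V} (hv : v ∈ AddSubmonoid.closure (ctx.base : Set V))
    (h : ⟪v, ctx.rho⟫ < 1) : v = 0 := by
  rcases ctx.closure_zero_or hv with h0 | ⟨b, hb, v', hv', rfl⟩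
  · exact h0
  · rw [inner_add_left, ctx.inner_rho hb] at h
    linarith [ctx.inner_rho_nonneg hv']

lemma eq_zero_of_closure_neg {v : V} (hv : v ∈ AddSubmonoid.closure (ctx.base : Set V))
    (hv' : -v ∈ AddSubmonoid.closure (ctx.base : Set V)) : v = 0 := by
  refine ctx.eq_zero_of_inner_rho_lt hv ?_
  have := ctx.inner_rho_nonneg hv'
  rw [inner_neg_left] at this
  linarith

lemma inner_rho_int {v : V} (hv : v ∈ AddSubmonoid.closure (ctx.base : Set V)) :
    ∃ k : ℤ, ⟪v, ctx.rho⟫ = k := by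
  induction hv using AddSubmonoid.closure_induction with
  | mem x hx => exact ⟨1, by simpa using ctx.inner_rho hx⟩
  | zero => exact ⟨0, by simp⟩
  | add x y _ _ hx hy =>
    obtain ⟨k, hk⟩ := hx
    obtain ⟨l, hl⟩ := hy
    exact ⟨k + l, by rw [inner_add_left, hk, hl]; push_cast; rfl⟩

lemma one_le_inner_rho {γ : V} (h : γ ∈ ctx.Pos) : 1 ≤ ⟪γ, ctx.rho⟫ := by
  by_contra! hlt
  exact ctx.ne_zero_of_mem (ctx.pos_subset h) (ctx.eq_zero_of_inner_rho_lt (ctx.pos_coords γ h) hlt)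

lemma pos_of_inner_rho_pos {γ : V} (hγ : γ ∈ ctx.Δ) (h : 0 < ⟪γ, ctx.rho⟫) : γ ∈ ctx.Pos := by
  refine (ctx.pos_or_neg γ hγ).resolve_right fun h' => ?_
  have := ctx.one_le_inner_rho h'
  rw [inner_neg_left] at this
  linarith

lemma sub_not_mem_of_base {α δ : V} (hα : α ∈ ctx.base) (hδ : δ ∈ ctx.base) (hne : α ≠ δ)
    {r s : ℝ} (hr : 0 < r) (hs : 0 < s) : r • α - s • δ ∉ ctx.Δ := by
  intro h
  rcases ctx.mem_closure_or h with h | h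
  · have := ctx.inner_fund_nonneg hδ h
    rw [inner_sub_left, inner_smul_left, inner_smul_left, ctx.inner_fund_self hδ,
      ctx.inner_fund_ne hα hne] at this
    simp at this
    linarith
  · have := ctx.inner_fund_nonneg hα h
    rw [inner_neg_left, inner_sub_left, inner_smul_left, inner_smul_left, ctx.inner_fund_self hα,
      ctx.inner_fund_ne hδ hne.symm] at this
    simp at this
    linarith

lemma inner_base_nonpos {α δ : V} (hα : α ∈ ctx.base) (hδ : δ ∈ ctx.base) (hne : α ≠ δ) :
    ⟪α, δ⟫ ≤ 0 := by
  by_contra! h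
  have hp : 0 < cartanPairing α δ :=
    div_pos (by linarith) (ctx.inner_self_pos (ctx.base_mem hδ))
  have := ctx.reflect_mem δ (ctx.base_mem hδ) α (ctx.base_mem hα)
  have h2 := ctx.sub_not_mem_of_base hα hδ hne one_pos hp
  rw [one_smul] at h2
  exact h2 this

end Base

section Pairing

variable {V : Type*} [NormedAddCommGroup V] [InnerProductSpace ℝ V] (ctx : RootSystemCtx V)

/-- Product of two opposite Cartan integers. -/
lemma pairing_mul_le {α γ : V} (hα : α ∈ ctx.Δ) (hγ : γ ∈ ctx.Δ) :
    cartanPairing α γ * cartanPairing γ α ≤ 4 := by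
  have h1 := ctx.inner_self_pos hα
  have h2 := ctx.inner_self_pos hγ
  have h3 := real_inner_mul_inner_self_le α γ
  unfold cartanPairing
  rw [div_mul_div_comm, div_le_iff₀ (by positivity), real_inner_comm α γ]
  nlinarith

lemma pairing_mul_nonneg {α γ : V} (hα : α ∈ ctx.Δ) (hγ : γ ∈ ctx.Δ) :
    0 ≤ cartanPairing α γ * cartanPairing γ α := by
  have h1 := ctx.inner_self_pos hα
  have h2 := ctx.inner_self_pos hγ
  unfold cartanPairing
  rw [div_mul_div_comm, real_inner_comm α γ]
  have : 0 ≤ 2 * ⟪α, γ⟫ * (2 * ⟪α, γ⟫) := mul_self_nonneg _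
  positivity

/-- Equality in the bound of Cartan integers forces proportionality. -/
lemma eq_smul_of_pairing_mul {α γ : V} (hα : α ∈ ctx.Δ) (hγ : γ ∈ ctx.Δ)
    (h : cartanPairing α γ * cartanPairing γ α = 4) :
    (2 : ℝ) • α = cartanPairing α γ • γ := by
  have h1 := ctx.inner_self_pos hα
  have h2 := ctx.inner_self_pos hγ
  have e1 := ctx.pairing_mul_self hγ (γ := α)
  have e2 := ctx.pairing_mul_self hα (γ := γ)
  rw [real_inner_comm α γ] at e2
  set n := cartanPairing α γ
  set m := cartanPairing γ α
  have h0 : ⟪(2 : ℝ) • α - n • γ, (2 : ℝ) • α - n • γ⟫ = 0 := by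
    simp only [inner_sub_left, inner_sub_right, real_inner_smul_left, real_inner_smul_right,
      real_inner_comm α γ]
    linear_combination -⟪α, α⟫ * h + n * e1 + n * e2
  exact sub_eq_zero.1 (inner_self_eq_zero.1 h0)

/-- Two roots at an acute angle are equal or differ by a root. -/
lemma eq_or_sub_mem {γ δ : V} (hγ : γ ∈ ctx.Δ) (hδ : δ ∈ ctx.Δ) (h : 0 < ⟪γ, δ⟫) :
    γ = δ ∨ γ - δ ∈ ctx.Δ := by
  obtain ⟨n, hn⟩ := ctx.pairing_int δ hδ γ hγ
  obtain ⟨m, hm⟩ := ctx.pairing_int γ hγ δ hδ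
  have hn0 : 0 < cartanPairing γ δ := div_pos (by linarith) (ctx.inner_self_pos hδ)
  have hm0 : 0 < cartanPairing δ γ :=
    div_pos (by rw [real_inner_comm]; linarith) (ctx.inner_self_pos hγ)
  have hle := ctx.pairing_mul_le hγ hδ
  have hn' : 0 < n := by rw [hn] at hn0; exact_mod_cast hn0
  have hm' : 0 < m := by rw [hm] at hm0; exact_mod_cast hm0
  have hle' : n * m ≤ 4 := by rw [hn, hm] at hle; exact_mod_cast hle
  by_cases n1 : n = 1
  · right
    have := ctx.pairing_symm_reflect hδ hγ hn
    simpa [n1] using this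
  by_cases m1 : m = 1
  · right
    have := ctx.neg_mem _ (ctx.pairing_symm_reflect hγ hδ hm)
    simpa [m1] using this
  left
  have hn2 : n = 2 := by nlinarith [show 2 ≤ n by omega, show 2 ≤ m by omega]
  have hm2 : m = 2 := by nlinarith [show 2 ≤ n by omega, show 2 ≤ m by omega]
  have := ctx.eq_smul_of_pairing_mul hγ hδ (by rw [hn, hm, hn2, hm2]; norm_num)
  rw [hn, hn2] at this
  push_cast at this
  exact smul_right_injective V (two_ne_zero (α := ℝ)) this

lemma pairing_eq_zero_iff {α γ : V} (hα : α ∈ ctx.Δ) : cartanPairing γ α = 0 ↔ ⟪γ, α⟫ = 0 := by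
  unfold cartanPairing
  simp [(ctx.ne_zero_of_mem hα)]

end Pairing

end RootSystemCtx

namespace RootSystemCtx

section Subsystems

variable {V : Type*} [NormedAddCommGroup V] [InnerProductSpace ℝ V] (ctx : RootSystemCtx V)

/-- A symmetric subset of roots, closed under reflections and under sums that are roots. -/
structure IsClosedSub (S : Finset V) : Prop where
  subset : S ⊆ ctx.Δ
  neg : ∀ a ∈ S, -a ∈ S
  add : ∀ a ∈ S, ∀ b ∈ S, a + b ∈ ctx.Δ → a + b ∈ S
  reflect : ∀ a ∈ S, ∀ b ∈ S, b - cartanPairing b a • a ∈ S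

/-- Any two members of `S` are linked by a chain of pairwise non-orthogonal members. -/
def IsLinked (S : Finset V) : Prop := ∀ a ∈ S, ∀ b ∈ S, Relation.ReflTransGen (connRel S) a b

lemma connRel_symm (S : Finset V) : Std.Symm (connRel S) :=
  ⟨fun _ _ h => ⟨h.2.1, h.1, by rw [real_inner_comm]; exact h.2.2⟩⟩

lemma mem_component {S : Finset V} {γ a : V} :
    a ∈ component S γ ↔ a ∈ S ∧ Relation.ReflTransGen (connRel S) γ a := by
  simp [component]

lemma mem_orthSub {S : Finset V} {β a : V} : a ∈ orthSub S β ↔ a ∈ S ∧ ⟪a, β⟫ = 0 := by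
  simp [orthSub]

lemma mem_component_of_inner_ne {S : Finset V} {γ a b : V} (ha : a ∈ component S γ) (hb : b ∈ S)
    (h : ⟪a, b⟫ ≠ 0) : b ∈ component S γ := by
  rw [mem_component] at ha ⊢
  exact ⟨hb, ha.2.tail ⟨ha.1, hb, h⟩⟩

lemma isClosedSub_top : ctx.IsClosedSub ctx.Δ :=
  ⟨subset_rfl, ctx.neg_mem, fun _ _ _ _ h => h, ctx.reflect_mem⟩

variable {ctx}

lemma IsClosedSub.orthSub {S : Finset V} (hS : ctx.IsClosedSub S) (β : V) :
    ctx.IsClosedSub (orthSub S β) where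
  subset a ha := hS.subset (mem_orthSub.1 ha).1
  neg a ha := by
    rw [mem_orthSub] at ha ⊢
    exact ⟨hS.neg a ha.1, by rw [inner_neg_left, ha.2, neg_zero]⟩
  add a ha b hb h := by
    rw [mem_orthSub] at ha hb ⊢
    exact ⟨hS.add a ha.1 b hb.1 h, by rw [inner_add_left, ha.2, hb.2, add_zero]⟩
  reflect a ha b hb := by
    rw [mem_orthSub] at ha hb ⊢
    exact ⟨hS.reflect a ha.1 b hb.1, by
      rw [inner_sub_left, real_inner_smul_left, ha.2, hb.2, mul_zero, sub_zero]⟩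

lemma inner_reflect_self {a b : V} (ha : a ∈ ctx.Δ) :
    ⟪b - cartanPairing b a • a, a⟫ = -⟪b, a⟫ := by
  rw [inner_sub_left, real_inner_smul_left, ctx.pairing_mul_self ha]
  ring

lemma IsClosedSub.component {S : Finset V} (hS : ctx.IsClosedSub S) (γ : V) :
    ctx.IsClosedSub (component S γ) where
  subset a ha := hS.subset (mem_component.1 ha).1
  neg a ha := by
    have h := (mem_component.1 ha).1
    refine mem_component_of_inner_ne ha (hS.neg a h) ?_
    rw [inner_neg_right]
    exact neg_ne_zero.2 (ctx.inner_self_pos (hS.subset h)).ne'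
  add a ha b hb h := by
    have h' := hS.add a (mem_component.1 ha).1 b (mem_component.1 hb).1 h
    by_cases h0 : ⟪a, a + b⟫ = 0
    · refine mem_component_of_inner_ne hb h' fun h1 => ?_
      have := ctx.inner_self_pos h
      rw [inner_add_left, h0, h1] at this
      simp at this
    · exact mem_component_of_inner_ne ha h' h0
  reflect a ha b hb := by
    by_cases h0 : ⟪b, a⟫ = 0
    · simpa [cartanPairing, h0] using hb
    · refine mem_component_of_inner_ne ha
        (hS.reflect a (mem_component.1 ha).1 b (mem_component.1 hb).1) ?_
      rw [real_inner_comm, inner_reflect_self (hS.subset (mem_component.1 ha).1)]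
      exact neg_ne_zero.2 h0

lemma isLinked_component (S : Finset V) (γ : V) : IsLinked (component S γ) := by
  have key : ∀ a, Relation.ReflTransGen (connRel S) γ a →
      Relation.ReflTransGen (connRel (_root_.component S γ)) γ a := by
    intro a h
    induction h with
    | refl => exact .refl
    | tail h1 h2 ih =>
      exact ih.tail ⟨mem_component.2 ⟨h2.1, h1⟩, mem_component.2 ⟨h2.2.1, h1.tail h2⟩, h2.2.2⟩
  intro a ha b hb
  have := connRel_symm (_root_.component S γ)
  exact (Std.Symm.symm _ _ (key a (mem_component.1 ha).2)).trans (key b (mem_component.1 hb).2)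

/-- A linked subset of `S` meeting a component of `S` lies inside it. -/
lemma IsLinked.subset_component {S T : Finset V} (hT : IsLinked T) (hTS : T ⊆ S) {γ a : V}
    (ha : a ∈ component S γ) (haT : a ∈ T) : T ⊆ component S γ := by
  intro b hb
  have h := hT a haT b hb
  induction h with
  | refl => exact ha
  | tail h1 h2 ih => exact mem_component_of_inner_ne (ih h2.1) (hTS h2.2.1) h2.2.2

variable (ctx) in
lemma isLinked_top : IsLinked ctx.Δ := by
  intro a ha
  have h := ctx.irreducible (component ctx.Δ a) (fun x hx => (mem_component.1 hx).1)
    ⟨a, mem_component.2 ⟨ha, .refl⟩⟩ (fun x hx b hb hbn => by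
      by_contra hne
      exact hbn (mem_component_of_inner_ne hx hb hne))
  intro b hb
  rw [← h] at hb
  exact (mem_component.1 hb).2

lemma smul_mem_closure {k : ℤ} (hk : 0 ≤ k) {v : V}
    (hv : v ∈ AddSubmonoid.closure (ctx.base : Set V)) :
    (k : ℝ) • v ∈ AddSubmonoid.closure (ctx.base : Set V) := by
  lift k to ℕ using hk
  rw [Int.cast_natCast, Nat.cast_smul_eq_nsmul]
  exact nsmul_mem hv k

/-- Members of a linked closed subset are at distance at most two from any given member. -/
lemma IsLinked.exists_middle {S : Finset V} (hS : ctx.IsClosedSub S) (hl : IsLinked S) {β δ : V}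
    (hβ : β ∈ S) (hδ : δ ∈ S) : ∃ γ ∈ S, ⟪γ, β⟫ ≠ 0 ∧ ⟪γ, δ⟫ ≠ 0 := by
  have h := hl β hβ δ hδ
  induction h with
  | refl =>
    exact ⟨β, hβ, (ctx.inner_self_pos (hS.subset hβ)).ne', (ctx.inner_self_pos (hS.subset hβ)).ne'⟩
  | @tail b c h1 h2 ih =>
    obtain ⟨γ, hγ, hγβ, hγb⟩ := ih h2.1
    by_cases hγc : ⟪γ, c⟫ = 0
    · by_cases hbβ : ⟪b, β⟫ = 0
      · refine ⟨_, hS.reflect b h2.1 γ hγ, ?_, ?_⟩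
        · rwa [inner_sub_left, real_inner_smul_left, hbβ, mul_zero, sub_zero]
        · rw [inner_sub_left, real_inner_smul_left, hγc, zero_sub, neg_ne_zero]
          refine mul_ne_zero (fun h0 => hγb ?_) h2.2.2
          exact (ctx.pairing_eq_zero_iff (hS.subset h2.1)).1 h0
      · exact ⟨b, h2.1, hbβ, h2.2.2⟩
    · exact ⟨γ, hγ, hγβ, hγc⟩

variable [FiniteDimensional ℝ V]

lemma IsHighest.inner_nonneg {S : Finset V} (hS : ctx.IsClosedSub S) {β γ : V}
    (hβ : ctx.IsHighest S β) (hγ : γ ∈ S) (hp : γ ∈ ctx.Pos) : 0 ≤ ⟪γ, β⟫ := by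
  by_contra! h
  have hlt : cartanPairing β γ < 0 :=
    div_neg_of_neg_of_pos (by rw [real_inner_comm]; linarith) (ctx.inner_self_pos (hS.subset hγ))
  have h1 := ctx.inner_rho_nonneg (hβ.2.2 _ (hS.reflect γ hγ β hβ.1))
  rw [sub_sub_cancel, real_inner_smul_left] at h1
  nlinarith [ctx.one_le_inner_rho hp]

lemma IsHighest.pos_of_inner_pos {S : Finset V} (hS : ctx.IsClosedSub S) {β γ : V}
    (hβ : ctx.IsHighest S β) (hγ : γ ∈ S) (h : 0 < ⟪γ, β⟫) : γ ∈ ctx.Pos := by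
  refine (ctx.pos_or_neg γ (hS.subset hγ)).resolve_right fun hn => ?_
  have := hβ.inner_nonneg hS (hS.neg γ hγ) hn
  rw [inner_neg_left] at this
  linarith

lemma IsHighest.unique {S : Finset V} {β β' : V} (h : ctx.IsHighest S β)
    (h' : ctx.IsHighest S β') : β = β' := by
  have h1 := h.2.2 _ h'.1
  have h2 := h'.2.2 _ h.1
  unfold rootLE at h1 h2
  rw [← neg_sub] at h2
  exact sub_eq_zero.1 (ctx.eq_zero_of_closure_neg h1 h2)

/-- A nonempty linked closed subset has a highest root. -/
lemma exists_isHighest {S : Finset V} (hS : ctx.IsClosedSub S) (hl : IsLinked S)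
    (hne : S.Nonempty) : ∃ β, ctx.IsHighest S β := by
  have hne' : (S.filter (· ∈ ctx.Pos)).Nonempty := by
    obtain ⟨a, ha⟩ := hne
    rcases ctx.pos_or_neg a (hS.subset ha) with h | h
    · exact ⟨a, by simp [ha, h]⟩
    · exact ⟨-a, by simp [hS.neg a ha, h]⟩
  obtain ⟨β, hβ, hmax⟩ := Finset.exists_max_image _ (fun v => ⟪v, ctx.rho⟫) hne'
  simp only [Finset.mem_filter, and_imp] at hβ hmax
  obtain ⟨hβS, hβP⟩ := hβ
  have hdom : ∀ γ ∈ S, γ ∈ ctx.Pos → 0 ≤ ⟪γ, β⟫ := by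
    intro γ hγ hp
    by_contra! h
    have hlt : cartanPairing β γ < 0 :=
      div_neg_of_neg_of_pos (by rw [real_inner_comm]; linarith) (ctx.inner_self_pos (hS.subset hγ))
    have hmem := hS.reflect γ hγ β hβS
    have h1 := ctx.one_le_inner_rho hp
    have h2 := ctx.one_le_inner_rho hβP
    have h3 : ⟪β - cartanPairing β γ • γ, ctx.rho⟫ > ⟪β, ctx.rho⟫ := by
      rw [inner_sub_left, real_inner_smul_left]
      nlinarith
    have h4 := hmax _ hmem (ctx.pos_of_inner_rho_pos (hS.subset hmem) (by linarith))
    linarith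
  have hpos : ∀ γ ∈ S, 0 < ⟪γ, β⟫ → γ ∈ ctx.Pos := by
    intro γ hγ h
    refine (ctx.pos_or_neg γ (hS.subset hγ)).resolve_right fun hn => ?_
    have := hdom _ (hS.neg γ hγ) hn
    rw [inner_neg_left] at this
    linarith
  have hstep : ∀ γ ∈ S, γ ∈ ctx.Pos → 0 < ⟪γ, β⟫ →
      β - γ ∈ AddSubmonoid.closure (ctx.base : Set V) := by
    intro γ hγ hp h
    rw [real_inner_comm] at h
    rcases ctx.eq_or_sub_mem (hS.subset hβS) (hS.subset hγ) h with rfl | h'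
    · rw [sub_self]; exact zero_mem _
    · rcases ctx.pos_or_neg _ h' with h'' | h''
      · exact ctx.pos_coords _ h''
      · have h1 := ctx.one_le_inner_rho h''
        have h2 := hmax γ hγ hp
        rw [inner_neg_left, inner_sub_left] at h1
        linarith
  refine ⟨β, hβS, hβP, fun δ hδ => ?_⟩
  unfold rootLE
  rcases ctx.pos_or_neg δ (hS.subset hδ) with hp | hn
  swap
  · rw [sub_eq_add_neg]
    exact add_mem (ctx.pos_coords _ hβP) (ctx.pos_coords _ hn)
  rcases (hdom δ hδ hp).lt_or_eq with h | h
  · exact hstep δ hδ hp h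
  obtain ⟨γ, hγ, hγβ, hγδ⟩ : ∃ γ ∈ S, 0 < ⟪γ, β⟫ ∧ ⟪γ, δ⟫ < 0 := by
    obtain ⟨γ, hγ, h1, h2⟩ : ∃ γ ∈ S, 0 < ⟪γ, β⟫ ∧ ⟪γ, δ⟫ ≠ 0 := by
      obtain ⟨γ, hγ, h1, h2⟩ := hl.exists_middle hS hβS hδ
      rcases lt_or_gt_of_ne h1 with h1 | h1
      · exact ⟨-γ, hS.neg γ hγ, by rw [inner_neg_left]; linarith,
          by rw [inner_neg_left]; exact neg_ne_zero.2 h2⟩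
      · exact ⟨γ, hγ, h1, h2⟩
    rcases lt_or_gt_of_ne h2 with h2 | h2
    · exact ⟨γ, hγ, h1, h2⟩
    · refine ⟨_, hS.neg _ (hS.reflect β hβS γ hγ), ?_, ?_⟩
      · rw [inner_neg_left, inner_reflect_self (hS.subset hβS), neg_neg]
        exact h1
      · rw [inner_neg_left, inner_sub_left, real_inner_smul_left, real_inner_comm δ β, ← h]
        linarith
  obtain ⟨k, hk⟩ := ctx.pairing_int δ (hS.subset hδ) γ (hS.subset hγ)
  have hk0 : k < 0 := by
    have : cartanPairing γ δ < 0 :=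
      div_neg_of_neg_of_pos (by linarith) (ctx.inner_self_pos (hS.subset hδ))
    rw [hk] at this
    exact_mod_cast this
  have hmem := hS.reflect δ hδ γ hγ
  have hin : 0 < ⟪γ - cartanPairing γ δ • δ, β⟫ := by
    rwa [inner_sub_left, real_inner_smul_left, ← h, mul_zero, sub_zero]
  have h1 := hstep _ hmem (hpos _ hmem hin) hin
  rw [hk] at h1
  have h2 := smul_mem_closure (ctx := ctx) (k := -k - 1) (by omega) (ctx.pos_coords δ hp)
  have h3 := add_mem (add_mem h1 (ctx.pos_coords γ (hpos γ hγ hγβ))) h2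
  convert h3 using 1
  push_cast
  module

end Subsystems

section Cascade

variable {V : Type*} [NormedAddCommGroup V] [InnerProductSpace ℝ V] [FiniteDimensional ℝ V]
  {ctx : RootSystemCtx V}

omit [FiniteDimensional ℝ V] in
lemma CascadeMem.spec {S : Finset V} {β : V} (h : ctx.CascadeMem S β) :
    ctx.IsClosedSub S ∧ IsLinked S ∧ ctx.IsHighest S β := by
  induction h with
  | top => exact ⟨ctx.isClosedSub_top, ctx.isLinked_top, ctx.pos_subset ctx.theta_mem,
      ctx.theta_mem, ctx.theta_highest⟩
  | step h hC hh ih =>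
    obtain ⟨γ, hγ, rfl⟩ := hC
    exact ⟨(ih.1.orthSub _).component γ, isLinked_component _ _, hh⟩

omit [FiniteDimensional ℝ V] in
lemma CascadeMem.closed {S : Finset V} {β : V} (h : ctx.CascadeMem S β) : ctx.IsClosedSub S :=
  h.spec.1

omit [FiniteDimensional ℝ V] in
lemma CascadeMem.linked {S : Finset V} {β : V} (h : ctx.CascadeMem S β) : IsLinked S := h.spec.2.1

omit [FiniteDimensional ℝ V] in
lemma CascadeMem.highest {S : Finset V} {β : V} (h : ctx.CascadeMem S β) : ctx.IsHighest S β :=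
  h.spec.2.2

omit [FiniteDimensional ℝ V] in
lemma CascadeMem.mem {S : Finset V} {β : V} (h : ctx.CascadeMem S β) : β ∈ S := h.highest.1

omit [FiniteDimensional ℝ V] in
lemma CascadeMem.mem_root {S : Finset V} {β : V} (h : ctx.CascadeMem S β) : β ∈ ctx.Δ :=
  h.closed.subset h.mem

/-- The relative position of two pairs of the cascade. -/
def CascRel (S : Finset V) (β : V) (S' : Finset V) (β' : V) : Prop :=
  (S = S' ∧ β = β') ∨ S' ⊆ orthSub S β ∨ S ⊆ orthSub S' β' ∨ ∀ a ∈ S, ∀ b ∈ S', ⟪a, b⟫ = 0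

omit [FiniteDimensional ℝ V] in
lemma CascRel.symm {S S' : Finset V} {β β' : V} (h : CascRel S β S' β') : CascRel S' β' S β := by
  rcases h with ⟨rfl, rfl⟩ | h | h | h
  · exact Or.inl ⟨rfl, rfl⟩
  · exact Or.inr (Or.inr (Or.inl h))
  · exact Or.inr (Or.inl h)
  · exact Or.inr (Or.inr (Or.inr fun a ha b hb => by rw [real_inner_comm]; exact h b hb a ha))

omit [FiniteDimensional ℝ V] in
lemma component_orthSub_subset (S : Finset V) (β γ : V) :
    component (orthSub S β) γ ⊆ orthSub S β := fun _ h => (mem_component.1 h).1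

omit [FiniteDimensional ℝ V] in
lemma orthSub_subset (S : Finset V) (β : V) : orthSub S β ⊆ S := fun _ h => (mem_orthSub.1 h).1

omit [FiniteDimensional ℝ V] in
lemma cascRel_top {S : Finset V} {β : V} (h : ctx.CascadeMem S β) :
    CascRel S β ctx.Δ ctx.θ := by
  have : (S = ctx.Δ ∧ β = ctx.θ) ∨ S ⊆ orthSub ctx.Δ ctx.θ := by
    induction h with
    | top => exact Or.inl ⟨rfl, rfl⟩
    | step h hC hh ih =>
      obtain ⟨γ, hγ, rfl⟩ := hC
      right
      rcases ih with ⟨rfl, rfl⟩ | ih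
      · exact component_orthSub_subset _ _ _
      · exact (component_orthSub_subset _ _ _).trans ((orthSub_subset _ _).trans ih)
  rcases this with h | h
  · exact Or.inl h
  · exact Or.inr (Or.inr (Or.inl h))

omit [FiniteDimensional ℝ V] in
lemma CascadeMem.not_self_orth {S : Finset V} {β : V} (h : ctx.CascadeMem S β) {T : Finset V} :
    β ∉ orthSub T β := fun hm =>
  (ctx.inner_self_pos h.mem_root).ne' (mem_orthSub.1 hm).2

/-- Two pairs of the cascade are equal, nested or orthogonal. -/
lemma cascRel_of_mem {S S' : Finset V} {β β' : V} (h : ctx.CascadeMem S β)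
    (h' : ctx.CascadeMem S' β') : CascRel S β S' β' := by
  induction h' generalizing S β with
  | top => exact cascRel_top h
  | @step S₀' C' β₀' β' h₀' hC' hh' ih' =>
    induction h with
    | top => exact (cascRel_top (.step h₀' hC' hh')).symm
    | @step S₀ C β₀ β h₀ hC hh ih =>
      have hcC := CascadeMem.step h₀ hC hh
      have hcC' := CascadeMem.step h₀' hC' hh'
      have e1 := ih' hcC
      have e3 := ih' h₀
      obtain ⟨γ, hγ, rfl⟩ := hC
      obtain ⟨γ', hγ', rfl⟩ := hC'
      have s' := component_orthSub_subset S₀' β₀' γ'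
      have s := component_orthSub_subset S₀ β₀ γ
      have t' := s'.trans (orthSub_subset _ _)
      have t := s.trans (orthSub_subset _ _)
      rcases e1 with ⟨e, e'⟩ | e1 | e1 | e1
      · right; left
        rw [e, e']
        exact s'
      · exact Or.inr (Or.inl (t'.trans e1))
      swap
      · exact Or.inr (Or.inr (Or.inr fun a ha b hb => e1 a ha b (t' hb)))
      rcases ih with ⟨e, e'⟩ | e2 | e2 | e2
      · right; right; left
        rw [← e, ← e']
        exact s
      swap
      · exact Or.inr (Or.inr (Or.inl (t.trans e2)))
      swap
      · exact Or.inr (Or.inr (Or.inr fun a ha b hb => e2 a (t ha) b hb))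
      rcases e3 with ⟨rfl, rfl⟩ | e3 | e3 | e3
      · by_cases hcasc : ∃ a ∈ component (orthSub S₀ β₀) γ,
            ∃ b ∈ component (orthSub S₀ β₀) γ', ⟪a, b⟫ ≠ 0
        · obtain ⟨a, ha, b, hb, hab⟩ := hcasc
          have hb' := mem_component_of_inner_ne ha (s' hb) hab
          have h1 := hcC'.linked.subset_component s' hb' hb
          have h2 := hcC.linked.subset_component s hb hb'
          have h3 := h2.antisymm h1
          left
          refine ⟨h3, ?_⟩
          rw [h3] at hh
          exact hh.unique hh'
        · push Not at hcasc
          exact Or.inr (Or.inr (Or.inr hcasc))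
      · have h1 := h₀'.linked.subset_component e3 hcC.mem (orthSub_subset _ _ (e1 hcC.mem))
        exact absurd (e1 (h1 h₀'.mem)) h₀'.not_self_orth
      · have h1 := h₀.linked.subset_component e3 hcC'.mem (orthSub_subset _ _ (e2 hcC'.mem))
        exact absurd (e2 (h1 h₀.mem)) h₀.not_self_orth
      · have := e3 β (t hcC.mem) β (orthSub_subset _ _ (e1 hcC.mem))
        exact absurd this (ctx.inner_self_pos hcC.mem_root).ne'

/-- Every root is non-orthogonal to the highest root of some member of the cascade. -/
lemma exists_cascadeMem {γ : V} (hγ : γ ∈ ctx.Δ) :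
    ∃ S β, ctx.CascadeMem S β ∧ γ ∈ S ∧ ⟪γ, β⟫ ≠ 0 := by
  have key : ∀ n : ℕ, ∀ S β, S.card = n → ctx.CascadeMem S β → γ ∈ S →
      ∃ S β, ctx.CascadeMem S β ∧ γ ∈ S ∧ ⟪γ, β⟫ ≠ 0 := by
    intro n
    induction n using Nat.strong_induction_on with
    | _ n ih =>
      intro S β hn h hγS
      by_cases h0 : ⟪γ, β⟫ = 0
      · have hγo : γ ∈ orthSub S β := mem_orthSub.2 ⟨hγS, h0⟩
        have hγc : γ ∈ component (orthSub S β) γ := mem_component.2 ⟨hγo, .refl⟩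
        obtain ⟨β', hβ'⟩ := exists_isHighest ((h.closed.orthSub β).component γ)
          (isLinked_component _ γ) ⟨γ, hγc⟩
        refine ih _ ?_ _ β' rfl (.step h ⟨γ, hγo, rfl⟩ hβ') hγc
        rw [← hn]
        refine Finset.card_lt_card ((Finset.ssubset_iff_of_subset
          ((component_orthSub_subset _ _ _).trans (orthSub_subset _ _))).2 ⟨β, h.mem, fun hm => ?_⟩)
        exact h.not_self_orth (component_orthSub_subset _ _ _ hm)
      · exact ⟨S, β, h, hγS, h0⟩
  exact key _ _ _ rfl .top hγ

variable {K : Finset V} (hK : ctx.IsCascade K)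
include hK

omit [FiniteDimensional ℝ V] in
lemma IsCascade.mem_root {β : V} (h : β ∈ K) : β ∈ ctx.Δ := by
  obtain ⟨S, hS⟩ := (hK β).1 h
  exact hS.mem_root

lemma IsCascade.orthogonal {β β' : V} (h : β ∈ K) (h' : β' ∈ K) (hne : β ≠ β') :
    ⟪β, β'⟫ = 0 := by
  obtain ⟨S, hS⟩ := (hK β).1 h
  obtain ⟨S', hS'⟩ := (hK β').1 h'
  rcases cascRel_of_mem hS hS' with ⟨-, h⟩ | h | h | h
  · exact absurd h hne
  · rw [real_inner_comm]; exact (mem_orthSub.1 (h hS'.mem)).2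
  · exact (mem_orthSub.1 (h hS.mem)).2
  · exact h β hS.mem β' hS'.mem

lemma IsCascade.inner_add_self_ne {β β' : V} (h : β ∈ K) (h' : β' ∈ K) (hne : β ≠ β') :
    ⟪β + β', β⟫ ≠ 0 ∧ ⟪β + β', β'⟫ ≠ 0 := by
  rw [inner_add_left, inner_add_left, hK.orthogonal h h' hne, hK.orthogonal h' h hne.symm, zero_add,
    add_zero]
  exact ⟨(ctx.inner_self_pos (hK.mem_root h)).ne', (ctx.inner_self_pos (hK.mem_root h')).ne'⟩

/-- Distinct elements of the cascade are strongly orthogonal. -/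
lemma IsCascade.add_not_mem {β β' : V} (h : β ∈ K) (h' : β' ∈ K) (hne : β ≠ β') :
    β + β' ∉ ctx.Δ := by
  intro hadd
  have nested : ∀ {S S' : Finset V} {b b' : V}, ctx.CascadeMem S b → ctx.CascadeMem S' b' →
      S' ⊆ S → b + b' ∉ ctx.Δ := by
    intro S S' b b' hS hS' hsub hadd
    have := hS.highest.2.2 _ (hS.closed.add b hS.mem b' (hsub hS'.mem) hadd)
    have h1 := ctx.inner_rho_nonneg this
    have h2 := ctx.one_le_inner_rho hS'.highest.2.1
    rw [sub_add_cancel_left, inner_neg_left] at h1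
    linarith
  obtain ⟨S, hS⟩ := (hK β).1 h
  obtain ⟨S', hS'⟩ := (hK β').1 h'
  rcases cascRel_of_mem hS hS' with ⟨-, e⟩ | e | e | e
  · exact hne e
  · exact nested hS hS' (e.trans (orthSub_subset _ _)) hadd
  · rw [add_comm] at hadd
    exact nested hS' hS (e.trans (orthSub_subset _ _)) hadd
  · obtain ⟨T, b, hT, hm, hb⟩ := exists_cascadeMem hadd
    have hn := hK.inner_add_self_ne h h' hne
    have h1 : ⟪β, b⟫ = 0 := by
      rcases cascRel_of_mem hT hS with ⟨rfl, -⟩ | e' | e' | e'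
      · exact absurd (e _ hm _ hS'.mem) hn.2
      · exact (mem_orthSub.1 (e' hS.mem)).2
      · exact absurd (mem_orthSub.1 (e' hm)).2 hn.1
      · exact absurd (e' _ hm _ hS.mem) hn.1
    have h2 : ⟪β', b⟫ = 0 := by
      rcases cascRel_of_mem hT hS' with ⟨rfl, -⟩ | e' | e' | e'
      · exact absurd (by rw [real_inner_comm]; exact e _ hS.mem _ hm) hn.1
      · exact (mem_orthSub.1 (e' hS'.mem)).2
      · exact absurd (mem_orthSub.1 (e' hm)).2 hn.2
      · exact absurd (e' _ hm _ hS'.mem) hn.2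
    exact hb (by rw [inner_add_left, h1, h2, add_zero])

lemma IsCascade.sub_not_mem {β β' : V} (h : β ∈ K) (h' : β' ∈ K) (hne : β ≠ β') :
    β - β' ∉ ctx.Δ := by
  intro hsub
  have h0 := hK.mem_root h'
  have h1 : cartanPairing (β - β') β' = -2 := by
    have := (ctx.inner_self_pos h0).ne'
    rw [cartanPairing, inner_sub_left, hK.orthogonal h h' hne]
    field_simp
    ring
  have h2 := ctx.reflect_mem _ h0 _ hsub
  rw [h1] at h2
  refine hK.add_not_mem h h' hne ?_
  convert h2 using 1
  module

end Cascade

end RootSystemCtx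

namespace RootSystemCtx

section Star

variable {V : Type*} [NormedAddCommGroup V] [InnerProductSpace ℝ V]

/-- The opposite of the product of the orthogonal reflections attached to the elements of `K`. -/
noncomputable def cascStar (K : Finset V) : V →ₗ[ℝ] V where
  toFun v := ∑ β ∈ K, cartanPairing v β • β - v
  map_add' v w := by
    have : ∀ β ∈ K, cartanPairing (v + w) β • β = cartanPairing v β • β + cartanPairing w β • β := by
      intro β _
      rw [← add_smul, cartanPairing, cartanPairing, cartanPairing, inner_add_left]
      congr 1
      ring
    rw [Finset.sum_congr rfl this, Finset.sum_add_distrib]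
    abel
  map_smul' r v := by
    have : ∀ β ∈ K, cartanPairing (r • v) β • β = r • cartanPairing v β • β := by
      intro β _
      rw [smul_smul, cartanPairing, cartanPairing, real_inner_smul_left]
      congr 1
      ring
    rw [Finset.sum_congr rfl this, ← Finset.smul_sum, RingHom.id_apply, smul_sub]

lemma cascStar_apply (K : Finset V) (v : V) :
    cascStar K v = ∑ β ∈ K, cartanPairing v β • β - v := rfl

lemma add_cascStar (K : Finset V) (v : V) :
    v + cascStar K v = ∑ β ∈ K, cartanPairing v β • β := by
  rw [cascStar_apply]
  abel

variable [FiniteDimensional ℝ V] {ctx : RootSystemCtx V} {K : Finset V} (hK : ctx.IsCascade K)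
include hK

lemma IsCascade.inner_sum_smul {K' : Finset V} (hK' : K' ⊆ K) (f : V → ℝ) {β : V} (hβ : β ∈ K) :
    ⟪∑ b ∈ K', f b • b, β⟫ = if β ∈ K' then f β * ⟪β, β⟫ else 0 := by
  rw [sum_inner, ← Finset.sum_ite_eq' K' β (fun _ => f β * ⟪β, β⟫)]
  refine Finset.sum_congr rfl fun b hb => ?_
  rw [real_inner_smul_left]
  split_ifs with h
  · rw [h]
  · rw [hK.orthogonal (hK' hb) hβ h, mul_zero]

lemma IsCascade.inner_cascStar (v : V) {β : V} (hβ : β ∈ K) : ⟪cascStar K v, β⟫ = ⟪v, β⟫ := by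
  rw [cascStar_apply, inner_sub_left, hK.inner_sum_smul subset_rfl _ hβ, if_pos hβ,
    ctx.pairing_mul_self (hK.mem_root hβ)]
  ring

lemma IsCascade.cascStar_cascStar (v : V) : cascStar K (cascStar K v) = v := by
  have : ∑ β ∈ K, cartanPairing (cascStar K v) β • β = ∑ β ∈ K, cartanPairing v β • β :=
    Finset.sum_congr rfl fun β hβ => by rw [cartanPairing, hK.inner_cascStar v hβ, cartanPairing]
  rw [cascStar_apply K (cascStar K v), this, cascStar_apply]
  abel

lemma IsCascade.inner_cascStar_cascStar (v w : V) :
    ⟪cascStar K v, cascStar K w⟫ = ⟪v, w⟫ := by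
  have h1 : ⟪cascStar K v, ∑ β ∈ K, cartanPairing w β • β⟫ =
      ⟪∑ β ∈ K, cartanPairing v β • β, w⟫ := by
    rw [inner_sum, sum_inner]
    refine Finset.sum_congr rfl fun β hβ => ?_
    rw [real_inner_smul_left, real_inner_smul_right, hK.inner_cascStar v hβ, cartanPairing,
      cartanPairing, real_inner_comm w β]
    ring
  rw [cascStar_apply K w, inner_sub_right, h1, ← add_cascStar, inner_add_left]
  ring

lemma IsCascade.inner_cascStar_comm (v w : V) : ⟪cascStar K v, w⟫ = ⟪v, cascStar K w⟫ := by
  rw [← hK.inner_cascStar_cascStar, hK.cascStar_cascStar]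

lemma IsCascade.cascStar_mem_root {γ : V} (hγ : γ ∈ ctx.Δ) : cascStar K γ ∈ ctx.Δ := by
  have key : ∀ K' ⊆ K, γ - ∑ β ∈ K', cartanPairing γ β • β ∈ ctx.Δ := by
    intro K'
    induction K' using Finset.induction_on with
    | empty => intro _; simpa using hγ
    | insert b s hb ih =>
      intro hs
      have hbK : b ∈ K := hs (Finset.mem_insert_self b s)
      have hsK : s ⊆ K := fun x hx => hs (Finset.mem_insert_of_mem hx)
      have h1 := ctx.reflect_mem b (hK.mem_root hbK) _ (ih hsK)
      have h2 : cartanPairing (γ - ∑ β ∈ s, cartanPairing γ β • β) b = cartanPairing γ b := by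
        rw [cartanPairing, inner_sub_left, hK.inner_sum_smul hsK _ hbK, if_neg hb, sub_zero,
          cartanPairing]
      rw [h2] at h1
      rw [Finset.sum_insert hb]
      convert h1 using 1
      abel
  have := ctx.neg_mem _ (key K subset_rfl)
  rwa [neg_sub] at this

lemma IsCascade.cascStar_mem_pos {γ : V} (hγ : γ ∈ ctx.Pos) : cascStar K γ ∈ ctx.Pos := by
  have hm := hK.cascStar_mem_root (ctx.pos_subset hγ)
  obtain ⟨S, β, hS, hγS, hne⟩ := exists_cascadeMem (ctx.pos_subset hγ)
  obtain ⟨S', β', hS', hγS', hne'⟩ := exists_cascadeMem hm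
  have hβ : β ∈ K := (hK β).2 ⟨S, hS⟩
  have hβ' : β' ∈ K := (hK β').2 ⟨S', hS'⟩
  rw [hK.inner_cascStar _ hβ'] at hne'
  have h0 := hK.inner_cascStar γ hβ
  have hpos : 0 < ⟪γ, β⟫ := lt_of_le_of_ne (hS.highest.inner_nonneg hS.closed hγS hγ) hne.symm
  rcases cascRel_of_mem hS hS' with ⟨rfl, rfl⟩ | h | h | h
  · exact hS.highest.pos_of_inner_pos hS.closed hγS' (h0 ▸ hpos)
  · rw [← h0] at hne
    exact absurd (mem_orthSub.1 (h hγS')).2 hne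
  · exact absurd (mem_orthSub.1 (h hγS)).2 hne'
  · exact absurd (h γ hγS β' hS'.mem) hne'

lemma IsCascade.cascStar_mem_closure {v : V} (hv : v ∈ AddSubmonoid.closure (ctx.base : Set V)) :
    cascStar K v ∈ AddSubmonoid.closure (ctx.base : Set V) := by
  induction hv using AddSubmonoid.closure_induction with
  | mem x hx => exact ctx.pos_coords _ (hK.cascStar_mem_pos (ctx.base_subset hx))
  | zero => rw [map_zero]; exact zero_mem _
  | add x y _ _ hx hy => rw [map_add]; exact add_mem hx hy

lemma IsCascade.cascStar_mem_base {α : V} (hα : α ∈ ctx.base) : cascStar K α ∈ ctx.base := by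
  have hp := hK.cascStar_mem_pos (ctx.base_subset hα)
  rcases ctx.closure_zero_or (ctx.pos_coords _ hp) with h | ⟨b, hb, v, hv, h⟩
  · exact absurd h (ctx.ne_zero_of_mem (ctx.pos_subset hp))
  · have h1 : α = cascStar K b + cascStar K v := by
      rw [← map_add, ← h, hK.cascStar_cascStar]
    have h2 := ctx.one_le_inner_rho (hK.cascStar_mem_pos (ctx.base_subset hb))
    have h3 := ctx.inner_rho hα
    rw [h1, inner_add_left] at h3
    have h4 := ctx.eq_zero_of_inner_rho_lt (hK.cascStar_mem_closure hv) (by linarith)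
    have h5 : v = 0 := by rw [← hK.cascStar_cascStar v, h4, map_zero]
    rwa [h, h5, add_zero]

end Star

end RootSystemCtx

namespace RootSystemCtx

section Parity

variable {V : Type*} [NormedAddCommGroup V] [InnerProductSpace ℝ V] [FiniteDimensional ℝ V]
  {ctx : RootSystemCtx V} {K : Finset V} (hK : ctx.IsCascade K)
include hK

omit [FiniteDimensional ℝ V] in
lemma IsCascade.exists_pairings {α : V} (hα : α ∈ ctx.Δ) : ∃ n m : V → ℤ,
    (∀ β ∈ K, cartanPairing α β = n β) ∧ (∀ β ∈ K, cartanPairing β α = m β) ∧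
    (∀ β ∈ K, 0 ≤ n β * m β) ∧ (∀ β ∈ K, n β * m β ≤ 4) ∧ (∀ β ∈ K, n β * m β = 0 → n β = 0) ∧
    ((∑ β ∈ K, n β * m β : ℤ) : ℝ) = 2 + cartanPairing (cascStar K α) α := by
  have h : ∀ β, ∃ n m : ℤ, β ∈ K → cartanPairing α β = n ∧ cartanPairing β α = m := by
    intro β
    by_cases hβ : β ∈ K
    · obtain ⟨n, hn⟩ := ctx.pairing_int β (hK.mem_root hβ) α hα
      obtain ⟨m, hm⟩ := ctx.pairing_int α hα β (hK.mem_root hβ)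
      exact ⟨n, m, fun _ => ⟨hn, hm⟩⟩
    · exact ⟨0, 0, fun h => absurd h hβ⟩
  choose n m hnm using h
  refine ⟨n, m, fun β hβ => (hnm β hβ).1, fun β hβ => (hnm β hβ).2, fun β hβ => ?_, fun β hβ => ?_,
    fun β hβ h0 => ?_, ?_⟩
  · have := ctx.pairing_mul_nonneg hα (hK.mem_root hβ)
    rw [(hnm β hβ).1, (hnm β hβ).2] at this
    exact_mod_cast this
  · have := ctx.pairing_mul_le hα (hK.mem_root hβ)
    rw [(hnm β hβ).1, (hnm β hβ).2] at this
    exact_mod_cast this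
  · rcases mul_eq_zero.1 h0 with h0 | h0
    · exact h0
    · have h1 := (hnm β hβ).2
      rw [h0, Int.cast_zero, ctx.pairing_eq_zero_iff hα, real_inner_comm,
        ← ctx.pairing_eq_zero_iff (hK.mem_root hβ), (hnm β hβ).1] at h1
      exact_mod_cast h1
  · have h1 := congrArg (fun v => 2 * ⟪v, α⟫ / ⟪α, α⟫) (add_cascStar K α)
    have h0 := (ctx.inner_self_pos hα).ne'
    simp only [inner_add_left, sum_inner, real_inner_smul_left] at h1
    rw [mul_add, add_div, mul_div_assoc, div_self h0, mul_one, Finset.mul_sum,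
      Finset.sum_div] at h1
    rw [cartanPairing, h1, Int.cast_sum]
    refine Finset.sum_congr rfl fun β hβ => ?_
    rw [Int.cast_mul, ← (hnm β hβ).1, ← (hnm β hβ).2]
    simp only [cartanPairing]
    ring

/-- If the simple root `α` is fixed by the opposition `cascStar K` or orthogonal to its image,
then its pairings with the cascade have an even sum. -/
lemma IsCascade.even_sum_pairing (hred : ∀ γ ∈ ctx.Δ, (2 : ℝ) • γ ∉ ctx.Δ) {α : V}
    (hα : α ∈ ctx.base) (h : cascStar K α = α ∨ cascStar K α ≠ α ∧ ⟪cascStar K α, α⟫ = 0) :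
    ∃ k : ℤ, ∑ β ∈ K, cartanPairing α β = 2 * k := by
  have hαΔ := ctx.base_mem hα
  obtain ⟨n, m, hn, hm, hnn, hle, hz, hsum⟩ := hK.exists_pairings hαΔ
  have hS : α + cascStar K α = ∑ β ∈ K, (n β : ℝ) • β := by
    rw [add_cascStar]
    exact Finset.sum_congr rfl fun β hβ => by rw [hn β hβ]
  suffices hev : Even (∑ β ∈ K, n β) by
    obtain ⟨k, hk⟩ := hev
    refine ⟨k, ?_⟩
    rw [Finset.sum_congr rfl hn, ← Int.cast_sum, hk]
    push_cast
    ring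
  have hα0 := (ctx.inner_self_pos hαΔ).ne'
  have hnegn : ∀ β : V, ∀ k : ℤ, (k = 1 ∨ k = -1) → ((k : ℝ) • β ∈ ctx.Δ ↔ β ∈ ctx.Δ) := by
    rintro β k (rfl | rfl)
    · simp
    · constructor
      · intro h; simpa using ctx.neg_mem _ h
      · intro h; simpa using ctx.neg_mem _ h
  by_cases hO : ∃ β₀ ∈ K, Odd (n β₀) ∧ Even (m β₀)
  swap
  · push Not at hO
    have hse : Even (∑ β ∈ K, n β * m β) := by
      rcases h with h | ⟨-, h⟩
      · rw [h, cartanPairing, mul_div_assoc, div_self hα0] at hsum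
        have : (∑ β ∈ K, n β * m β : ℤ) = 4 := by
          have : ((∑ β ∈ K, n β * m β : ℤ) : ℝ) = (4 : ℤ) := by rw [hsum]; norm_num
          exact_mod_cast this
        rw [this]; decide
      · rw [cartanPairing, h] at hsum
        have : (∑ β ∈ K, n β * m β : ℤ) = 2 := by
          have : ((∑ β ∈ K, n β * m β : ℤ) : ℝ) = (2 : ℤ) := by rw [hsum]; norm_num
          exact_mod_cast this
        rw [this]; decide
    have hd : Even (∑ β ∈ K, (n β - n β * m β)) := by
      refine Finset.even_sum _ fun β hβ => ?_
      have := hO β hβ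
      rcases Int.even_or_odd (n β) with h1 | h1
      · exact h1.sub (h1.mul_right _)
      · have h2 : Odd (m β) := Int.not_even_iff_odd.1 fun h' => this h1 h'
        exact h1.sub_odd (h1.mul h2)
    have := hd.add hse
    rwa [← Finset.sum_add_distrib, Finset.sum_congr rfl fun β _ => sub_add_cancel _ _] at this
  obtain ⟨β₀, hβ₀, hodd, heven⟩ := hO
  have hβ₀Δ := hK.mem_root hβ₀
  have hval : (n β₀ = 1 ∨ n β₀ = -1) ∧ (n β₀ * m β₀ = 2 ∧ m β₀ = 2 * n β₀ ∨ n β₀ * m β₀ = 4) := by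
    have h1 := hnn _ hβ₀
    have h2 := hle _ hβ₀
    have h3 : n β₀ * m β₀ ≠ 0 := fun h => by rw [hz _ hβ₀ h] at hodd; exact absurd hodd (by decide)
    obtain ⟨b, hb⟩ := heven
    obtain ⟨a, ha⟩ := hodd
    have hbn : n β₀ * b = 1 ∨ n β₀ * b = 2 := by
      have : n β₀ * m β₀ = 2 * (n β₀ * b) := by rw [hb]; ring
      omega
    rcases hbn with hbn | hbn
    · rcases Int.eq_one_or_neg_one_of_mul_eq_one hbn with h4 | h4
      · rw [h4] at hbn ⊢; omega
      · rw [h4] at hbn ⊢; omega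
    · have h5 : n β₀ ∣ 2 := ⟨b, hbn.symm⟩
      have h6 := Int.le_of_dvd (by norm_num) h5
      have h7 := Int.le_of_dvd (by norm_num) ((neg_dvd).2 h5)
      have h8 : n β₀ = 1 ∨ n β₀ = -1 := by omega
      rcases h8 with h4 | h4
      · rw [h4] at hbn ⊢; omega
      · rw [h4] at hbn ⊢; omega
  obtain ⟨hn1, hnm⟩ := hval
  have hrest0 : ∀ s ⊆ K, ∑ β ∈ s, n β * m β = 0 → ∀ β ∈ s, n β = 0 := fun s hs h0 β hβ =>
    hz β (hs hβ) ((Finset.sum_eq_zero_iff_of_nonneg fun b hb => hnn b (hs hb)).1 h0 β hβ)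
  have hpick : ∀ s ⊆ K, ∑ β ∈ s, n β * m β ≠ 0 →
      ∃ b ∈ s, n b * m b ≠ 0 ∧ 0 < n b * m b ∧
        ∑ β ∈ s.erase b, n β * m β = ∑ β ∈ s, n β * m β - n b * m b ∧
        ∑ β ∈ s.erase b, n β = ∑ β ∈ s, n β - n b ∧
        ∑ β ∈ s.erase b, (n β : ℝ) • β = ∑ β ∈ s, (n β : ℝ) • β - (n b : ℝ) • b := by
    intro s hs h0
    obtain ⟨b, hb, hb0⟩ := Finset.exists_ne_zero_of_sum_ne_zero h0
    refine ⟨b, hb, hb0, lt_of_le_of_ne (hnn b (hs hb)) hb0.symm, ?_, ?_, ?_⟩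
    · rw [← Finset.add_sum_erase _ _ hb]; abel
    · rw [← Finset.add_sum_erase _ _ hb]; abel
    · rw [← Finset.add_sum_erase _ _ hb]; abel
  have hsplit := Finset.add_sum_erase K (fun β => n β * m β) hβ₀
  have hsplitn := Finset.add_sum_erase K n hβ₀
  have hsplitv := Finset.add_sum_erase K (fun β => (n β : ℝ) • β) hβ₀
  have hK₀ : K.erase β₀ ⊆ K := Finset.erase_subset _ _
  have hsum0 : ∀ s : Finset V, (∀ β ∈ s, n β = 0) → ∑ β ∈ s, (n β : ℝ) • β = 0 := fun s hs =>
    Finset.sum_eq_zero fun β hβ => by rw [hs β hβ, Int.cast_zero, zero_smul]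
  rcases h with h | ⟨hne, h⟩
  · have hs4 : (∑ β ∈ K, n β * m β : ℤ) = 4 := by
      rw [h, cartanPairing, mul_div_assoc, div_self hα0] at hsum
      have : ((∑ β ∈ K, n β * m β : ℤ) : ℝ) = (4 : ℤ) := by rw [hsum]; norm_num
      exact_mod_cast this
    rw [h] at hS
    rcases hnm with ⟨hnm, hm2⟩ | hnm
    · have hR : ∑ β ∈ K.erase β₀, (n β : ℝ) • β ∈ ctx.Δ := by
        have h1 := ctx.reflect_mem α hαΔ β₀ hβ₀Δ
        rw [← hnegn _ (-n β₀) (by omega), hm β₀ hβ₀, hm2] at h1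
        convert h1 using 1
        rw [← hsplitv] at hS
        rw [eq_sub_iff_add_eq'.2 hS.symm]
        have hsq : (n β₀ : ℝ) * n β₀ = 1 := by rcases hn1 with h | h <;> simp [h]
        push_cast
        rw [smul_sub, smul_smul, show -(n β₀ : ℝ) * (2 * n β₀) = -2 * (n β₀ * n β₀) by ring, hsq]
        module
      have hr2 : ∑ β ∈ K.erase β₀, n β * m β = 2 := by omega
      obtain ⟨β₁, hβ₁, h1ne, h1pos, h1s, h1n, h1v⟩ := hpick _ hK₀ (by rw [hr2]; norm_num)
      have hβ₁K := hK₀ hβ₁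
      have hK₁ : (K.erase β₀).erase β₁ ⊆ K := (Finset.erase_subset _ _).trans hK₀
      have h1le : n β₁ * m β₁ = 1 ∨ n β₁ * m β₁ = 2 := by
        have := Finset.sum_nonneg fun β hβ => hnn β (hK₁ hβ)
        omega
      rcases h1le with h1le | h1le
      · have hn1' := Int.eq_one_or_neg_one_of_mul_eq_one h1le
        obtain ⟨β₂, hβ₂, h2ne, h2pos, h2s, h2n, h2v⟩ := hpick _ hK₁ (by omega)
        have hβ₂K := hK₁ hβ₂
        have hK₂ : ((K.erase β₀).erase β₁).erase β₂ ⊆ K := (Finset.erase_subset _ _).trans hK₁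
        have h2le : n β₂ * m β₂ = 1 := by
          have := Finset.sum_nonneg fun β hβ => hnn β (hK₂ hβ)
          omega
        have hn2' := Int.eq_one_or_neg_one_of_mul_eq_one h2le
        rw [hsum0 _ (hrest0 _ hK₂ (by omega)), h1v] at h2v
        rw [show ∑ β ∈ K.erase β₀, (n β : ℝ) • β = (n β₁ : ℝ) • β₁ + (n β₂ : ℝ) • β₂ by
          rw [← sub_eq_zero, h2v]; abel] at hR
        have hne12 : β₁ ≠ β₂ := (Finset.ne_of_mem_erase hβ₂).symm
        exfalso
        rcases hn1' with e1 | e1 <;> rcases hn2' with e2 | e2 <;>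
          simp only [e1, e2, Int.cast_one, Int.cast_neg, one_smul, neg_smul] at hR
        · exact hK.add_not_mem hβ₁K hβ₂K hne12 hR
        · rw [← sub_eq_add_neg] at hR
          exact hK.sub_not_mem hβ₁K hβ₂K hne12 hR
        · rw [neg_add_eq_sub] at hR
          exact hK.sub_not_mem hβ₂K hβ₁K hne12.symm hR
        · have := ctx.neg_mem _ hR
          rw [neg_add, neg_neg, neg_neg] at this
          exact hK.add_not_mem hβ₁K hβ₂K hne12 this
      · have hz1 := hrest0 _ hK₁ (by omega)
        rw [hsum0 _ hz1] at h1v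
        rw [Finset.sum_eq_zero hz1] at h1n
        rcases Int.even_or_odd (n β₁) with he | ho
        · exfalso
          have h5 : n β₁ ∣ 2 := ⟨m β₁, h1le.symm⟩
          have h6 := Int.le_of_dvd (by norm_num) h5
          have h7 := Int.le_of_dvd (by norm_num) ((neg_dvd).2 h5)
          obtain ⟨c, hc⟩ := he
          have h8 : c = 1 ∨ c = -1 := by
            have : n β₁ ≠ 0 := fun h0 => by rw [h0] at h1ne; simp at h1ne
            omega
          rw [sub_eq_zero.1 h1v.symm, hc, Int.cast_add, ← two_mul, mul_comm, ← smul_smul,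
            hnegn _ _ h8] at hR
          exact hred _ (hK.mem_root hβ₁K) hR
        · rw [← hsplitn, show ∑ β ∈ K.erase β₀, n β = n β₁ by omega]
          exact hodd.add_odd ho
    · exfalso
      have hz0 := hsum0 _ (hrest0 _ hK₀ (by omega))
      rw [hz0, add_zero] at hsplitv
      rw [← hsplitv, ← two_smul ℝ] at hS
      exact hred α hαΔ (hS ▸ (hnegn _ _ hn1).2 hβ₀Δ)
  · exfalso
    have hs2 : (∑ β ∈ K, n β * m β : ℤ) = 2 := by
      rw [cartanPairing, h] at hsum
      have : ((∑ β ∈ K, n β * m β : ℤ) : ℝ) = (2 : ℤ) := by rw [hsum]; norm_num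
      exact_mod_cast this
    have hge : n β₀ * m β₀ = 2 := by
      have := Finset.sum_nonneg fun β hβ => hnn β (hK₀ hβ)
      omega
    have hz0 := hsum0 _ (hrest0 _ hK₀ (by omega))
    rw [hz0, add_zero] at hsplitv
    rw [← hsplitv] at hS
    have h1 := ctx.reflect_mem α hαΔ _ (hS ▸ (hnegn _ _ hn1).2 hβ₀Δ)
    rw [show cartanPairing (α + cascStar K α) α = 2 by
      rw [cartanPairing, inner_add_left, h, add_zero, mul_div_assoc, div_self hα0, mul_one]] at h1
    refine ctx.sub_not_mem_of_base (hK.cascStar_mem_base hα) hα hne one_pos one_pos ?_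
    convert h1 using 1
    module

end Parity

end RootSystemCtx

namespace RootSystemCtx

section Connected

variable {V : Type*} [NormedAddCommGroup V] [InnerProductSpace ℝ V]

lemma inner_eq_zero_of_mem_span {B B' : Finset V} (h : ∀ a ∈ B, ∀ b ∈ B', ⟪a, b⟫ = 0) {v w : V}
    (hv : v ∈ Submodule.span ℝ (B : Set V)) (hw : w ∈ Submodule.span ℝ (B' : Set V)) :
    ⟪v, w⟫ = 0 := by
  induction hv using Submodule.span_induction with
  | mem x hx =>
    induction hw using Submodule.span_induction with
    | mem y hy => exact h x hx y hy
    | zero => exact inner_zero_right _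
    | add y z _ _ hy hz => rw [inner_add_right, hy, hz, add_zero]
    | smul r y _ hy => rw [real_inner_smul_right, hy, mul_zero]
  | zero => exact inner_zero_left _
  | add x y _ _ hx hy => rw [inner_add_left, hx, hy, add_zero]
  | smul r x _ hx => rw [real_inner_smul_left, hx, mul_zero]

variable [FiniteDimensional ℝ V] (ctx : RootSystemCtx V)

lemma inner_fund_of_mem_span {B : Finset V} (hB : B ⊆ ctx.base) {a v : V} (ha : a ∉ B)
    (hv : v ∈ Submodule.span ℝ (B : Set V)) : ⟪v, ctx.fund a⟫ = 0 := by
  induction hv using Submodule.span_induction with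
  | mem x hx => exact ctx.inner_fund_ne (hB hx) fun h => ha (h ▸ hx)
  | zero => exact inner_zero_left _
  | add x y _ _ hx hy => rw [inner_add_left, hx, hy, add_zero]
  | smul r x _ hx => rw [real_inner_smul_left, hx, mul_zero]

lemma mem_span_or_of_orthogonal {B B' : Finset V} (hB : B ⊆ ctx.base) (hB' : B' ⊆ ctx.base)
    (hd : ∀ a ∈ B, a ∉ B')
    (hcov : ∀ a ∈ ctx.base, a ∈ B ∨ a ∈ B') (h : ∀ a ∈ B, ∀ b ∈ B', ⟪a, b⟫ = 0) {γ : V}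
    (hγ : γ ∈ ctx.Pos) :
    γ ∈ Submodule.span ℝ (B : Set V) ∨ γ ∈ Submodule.span ℝ (B' : Set V) := by
  have key : ∀ n : ℕ, ∀ γ ∈ ctx.Pos, ⟪γ, ctx.rho⟫ ≤ n →
      γ ∈ Submodule.span ℝ (B : Set V) ∨ γ ∈ Submodule.span ℝ (B' : Set V) := by
    intro n
    induction n with
    | zero =>
      intro γ hγ hle
      have := ctx.one_le_inner_rho hγ
      push_cast at hle
      linarith
    | succ n ih =>
      intro γ hγ hle
      have hγΔ := ctx.pos_subset hγ
      obtain ⟨α, hα, hpos⟩ : ∃ α ∈ ctx.base, 0 < ⟪γ, α⟫ := by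
        by_contra! hcon
        have := ctx.inner_nonneg_of_mem_closure (w := -γ) (fun b hb => by
          rw [inner_neg_right, real_inner_comm]; linarith [hcon b hb]) (ctx.pos_coords γ hγ)
        rw [inner_neg_right] at this
        linarith [ctx.inner_self_pos hγΔ]
      have hαspan : ∀ {C : Finset V}, α ∈ C → α ∈ Submodule.span ℝ (C : Set V) := fun hC =>
        Submodule.subset_span hC
      have hα1 := ctx.inner_rho hα
      rcases ctx.eq_or_sub_mem hγΔ (ctx.base_mem hα) hpos with rfl | hsub
      · exact (hcov γ hα).imp hαspan hαspan
      have hp : γ - α ∈ ctx.Pos := by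
        refine (ctx.pos_or_neg _ hsub).resolve_right fun hn => ?_
        have h1 := ctx.one_le_inner_rho hn
        have h2 := ctx.one_le_inner_rho hγ
        rw [inner_neg_left, inner_sub_left] at h1
        linarith
      have hmix : ∀ {C C' : Finset V}, C ⊆ ctx.base → α ∉ C → α ∈ C' →
          (∀ a ∈ C, ∀ b ∈ C', ⟪a, b⟫ = 0) → γ - α ∉ Submodule.span ℝ (C : Set V) := by
        intro C C' hC hαC hαC' horth hm
        have h1 := inner_eq_zero_of_mem_span horth hm (hαspan hαC')
        have h2 : cartanPairing γ α = 2 := by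
          have := (ctx.inner_self_pos (ctx.base_mem hα)).ne'
          rw [inner_sub_left, sub_eq_zero] at h1
          rw [cartanPairing, h1]
          field_simp
        have h3 := ctx.reflect_mem α (ctx.base_mem hα) γ hγΔ
        rw [h2] at h3
        have h4 := ctx.inner_fund_of_mem_span hC hαC hm
        have h5 := ctx.inner_fund_self hα
        have h6 := ctx.one_le_inner_rho hp
        rw [inner_sub_left] at h4 h6
        rcases ctx.pos_or_neg _ h3 with h7 | h7
        · have := ctx.inner_fund_nonneg hα (ctx.pos_coords _ h7)
          rw [inner_sub_left, real_inner_smul_left] at this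
          linarith
        · have := ctx.one_le_inner_rho h7
          rw [inner_neg_left, inner_sub_left, real_inner_smul_left] at this
          linarith
      have hle' : ⟪γ - α, ctx.rho⟫ ≤ n := by
        rw [inner_sub_left, hα1]
        push_cast at hle
        linarith
      have hback : ∀ {C : Finset V}, γ - α ∈ Submodule.span ℝ (C : Set V) → α ∈ C →
          γ ∈ Submodule.span ℝ (C : Set V) := fun h1 h2 => by
        have := add_mem h1 (hαspan h2)
        rwa [sub_add_cancel] at this
      rcases ih _ hp hle' with h1 | h1 <;> rcases hcov α hα with h2 | h2
      · exact Or.inl (hback h1 h2)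
      · exact absurd h1 (hmix hB (fun h' => hd α h' h2) h2 h)
      · exact absurd h1 (hmix hB' (hd α h2) h2 fun a ha b hb => by
          rw [real_inner_comm]; exact h b hb a ha)
      · exact Or.inr (hback h1 h2)
  obtain ⟨n, hn⟩ := exists_nat_ge ⟪γ, ctx.rho⟫
  exact key n γ hγ hn

/-- The base of an irreducible root system is connected. -/
lemma exists_base_inner_ne {B : Finset V} (hB : B ⊆ ctx.base) (hne : B.Nonempty)
    (hproper : ∃ a ∈ ctx.base, a ∉ B) : ∃ a ∈ ctx.base, a ∉ B ∧ ∃ b ∈ B, ⟪a, b⟫ ≠ 0 := by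
  by_contra! hcon
  obtain ⟨a₀, ha₀, ha₀B⟩ := hproper
  obtain ⟨b₀, hb₀⟩ := hne
  have hB' : ctx.base \ B ⊆ ctx.base := Finset.sdiff_subset
  have horth : ∀ a ∈ B, ∀ b ∈ ctx.base \ B, ⟪a, b⟫ = 0 := fun a ha b hb => by
    rw [real_inner_comm]
    exact hcon b (Finset.mem_sdiff.1 hb).1 (Finset.mem_sdiff.1 hb).2 a ha
  have hor : ∀ γ ∈ ctx.Δ, γ ∈ Submodule.span ℝ (B : Set V) ∨
      γ ∈ Submodule.span ℝ ((ctx.base \ B : Finset V) : Set V) := by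
    intro γ hγ
    have := fun {γ} (h : γ ∈ ctx.Pos) => ctx.mem_span_or_of_orthogonal hB hB'
      (fun a ha h => (Finset.mem_sdiff.1 h).2 ha)
      (fun a ha => by by_cases h : a ∈ B <;> simp [h, ha]) horth h
    rcases ctx.pos_or_neg γ hγ with h | h
    · exact this h
    · exact (this h).imp (fun h => (Submodule.neg_mem_iff _).1 h) (fun h => (Submodule.neg_mem_iff _).1 h)
  have hS := ctx.irreducible (ctx.Δ.filter (· ∈ Submodule.span ℝ (B : Set V)))
    (Finset.filter_subset _ _)
    ⟨b₀, Finset.mem_filter.2 ⟨ctx.base_mem (hB hb₀), Submodule.subset_span hb₀⟩⟩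
    (fun a ha b hb hbn => inner_eq_zero_of_mem_span horth (Finset.mem_filter.1 ha).2
      ((hor b hb).resolve_left fun h => hbn (Finset.mem_filter.2 ⟨hb, h⟩)))
  have h1 := ctx.base_mem ha₀
  rw [← hS, Finset.mem_filter] at h1
  have h2 := ctx.inner_fund_of_mem_span hB ha₀B h1.2
  rw [ctx.inner_fund_self ha₀] at h2
  exact one_ne_zero h2

end Connected

end RootSystemCtx

namespace RootSystemCtx

section Chain

variable {V : Type*} [NormedAddCommGroup V] [InnerProductSpace ℝ V]

/-- Normalised Gram matrix of a chain of simple roots of type `A`. -/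
noncomputable def chainGram (i j : ℕ) : ℝ :=
  if i = j then 1 else if i + 1 = j ∨ j + 1 = i then -1 / 2 else 0

/-- A chain of simple roots `p 0, …, p (n - 1)` of type `Aₙ` which together with its image under
the opposition `cascStar K` forms a chain of type `A₂ₙ`, joined at `p 0`. -/
structure IsHalfChain (ctx : RootSystemCtx V) (K : Finset V) (c : ℝ) (n : ℕ) (p : ℕ → V) :
    Prop where
  mem : ∀ i < n, p i ∈ ctx.base
  inner : ∀ i < n, ∀ j < n, ⟪p i, p j⟫ = c * chainGram i j
  inner_star : ∀ i < n, ∀ j < n, ⟪p i, cascStar K (p j)⟫ = c * if i = 0 ∧ j = 0 then -1 / 2 else 0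

/-- The sum of the first `k` members of a chain and of their images under the opposition. -/
noncomputable def chainSum (K : Finset V) (p : ℕ → V) (k : ℕ) : V :=
  ∑ i ∈ Finset.range k, (p i + cascStar K (p i))

variable [FiniteDimensional ℝ V] {ctx : RootSystemCtx V} {K : Finset V} (hK : ctx.IsCascade K)
  {c : ℝ} {n : ℕ} {p : ℕ → V}
include hK

lemma IsHalfChain.inner_star' (hp : ctx.IsHalfChain K c n p) {i j : ℕ} (hi : i < n) (hj : j < n) :
    ⟪cascStar K (p i), p j⟫ = c * if i = 0 ∧ j = 0 then -1 / 2 else 0 := by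
  rw [hK.inner_cascStar_comm, hp.inner_star i hi j hj]

lemma cascStar_chainSum (k : ℕ) : cascStar K (chainSum K p k) = chainSum K p k := by
  rw [chainSum, map_sum]
  refine Finset.sum_congr rfl fun i _ => ?_
  rw [map_add, hK.cascStar_cascStar, add_comm]

lemma IsHalfChain.chainSum_mem (hp : ctx.IsHalfChain K c n p) {k : ℕ} (hk : k ≤ n) :
    chainSum K p k ∈ AddSubmonoid.closure (ctx.base : Set V) := by
  refine sum_mem fun i hi => add_mem ?_ ?_
  · exact AddSubmonoid.subset_closure (hp.mem i ((Finset.mem_range.1 hi).trans_le hk))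
  · exact AddSubmonoid.subset_closure
      (hK.cascStar_mem_base (hp.mem i ((Finset.mem_range.1 hi).trans_le hk)))

lemma IsHalfChain.inner_chainSum (hp : ctx.IsHalfChain K c n p) {k i : ℕ} (hk : k + 1 ≤ n)
    (hi : i < n) : ⟪chainSum K p (k + 1), p i⟫ =
      c * if i = k then 1 / 2 else if i = k + 1 then -1 / 2 else 0 := by
  induction k with
  | zero =>
    rw [chainSum, zero_add, Finset.sum_range_one, inner_add_left, hp.inner 0 (by omega) i hi,
      hp.inner_star' hK (by omega) hi, ← mul_add, chainGram]
    congr 1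
    split_ifs <;> first | omega | (norm_num; done) | (exfalso; simp_all)
  | succ k ih =>
    have := ih (by omega)
    rw [chainSum] at this
    rw [chainSum, Finset.sum_range_succ, inner_add_left, this, inner_add_left,
      hp.inner (k + 1) (by omega) i hi, hp.inner_star' hK (by omega) hi, ← mul_add, ← mul_add,
      chainGram]
    congr 1
    split_ifs <;> first | omega | (norm_num; done) | (exfalso; simp_all)

lemma IsHalfChain.inner_chainSum_self (hp : ctx.IsHalfChain K c n p) {k : ℕ} (hk : k + 1 ≤ n) :
    ⟪chainSum K p (k + 1), chainSum K p (k + 1)⟫ = c := by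
  have h : ∀ i ∈ Finset.range (k + 1), ⟪chainSum K p (k + 1), p i + cascStar K (p i)⟫ =
      if i = k then c else 0 := by
    intro i hi
    have hi := Finset.mem_range.1 hi
    rw [inner_add_right, ← hK.inner_cascStar_comm, cascStar_chainSum hK,
      hp.inner_chainSum hK hk (by omega), if_neg (show ¬ i = k + 1 by omega)]
    split_ifs <;> ring
  conv_lhs => rw [show chainSum K p (k + 1) = ∑ i ∈ Finset.range (k + 1), (p i + cascStar K (p i))
    from rfl, inner_sum]
  rw [← show chainSum K p (k + 1) = ∑ i ∈ Finset.range (k + 1), (p i + cascStar K (p i)) from rfl,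
    Finset.sum_congr rfl h, Finset.sum_ite_eq']
  simp

/-- Attaching a simple root to a half-chain which is joined to exactly one of its members. -/
lemma IsHalfChain.snoc (hp : ctx.IsHalfChain K c n p) {a : V} {j : ℕ}
    (hj : j < n) (ha : a ∈ ctx.base) (haa : ⟪a, a⟫ = c) (has : ⟪a, cascStar K a⟫ = 0)
    (hap : ∀ i < n, ⟪a, p i⟫ = c * if i = j then -1 / 2 else 0)
    (hasp : ∀ i < n, ⟪a, cascStar K (p i)⟫ = 0) :
    ctx.IsHalfChain K c (n + 1) (fun i => if i < n then p i else a) := by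
  have hjn : j + 1 = n := by
    by_contra hne
    have hjn : j + 1 < n := by omega
    set W := chainSum K p (j + 1) with hW
    have hWW : ⟪W, W⟫ = c := hp.inner_chainSum_self hK hj
    have hWs : cascStar K W = W := cascStar_chainSum hK _
    have hWa : ⟪W, a⟫ = -c / 2 := by
      rw [hW, chainSum, sum_inner]
      have : ∀ i ∈ Finset.range (j + 1), ⟪p i + cascStar K (p i), a⟫ =
          if i = j then -c / 2 else 0 := by
        intro i hi
        have hi := Finset.mem_range.1 hi
        rw [real_inner_comm, inner_add_right, hap i (by omega), hasp i (by omega)]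
        split_ifs <;> ring
      rw [Finset.sum_congr rfl this, Finset.sum_ite_eq']
      simp
    have hWp : ⟪W, p (j + 1)⟫ = -c / 2 := by
      rw [hp.inner_chainSum hK hj hjn]
      simp
      ring
    have hWa' : ⟪W, cascStar K a⟫ = -c / 2 := by rw [← hK.inner_cascStar_comm, hWs, hWa]
    have hWp' : ⟪W, cascStar K (p (j + 1))⟫ = -c / 2 := by
      rw [← hK.inner_cascStar_comm, hWs, hWp]
    have hpp : ⟪p (j + 1), p (j + 1)⟫ = c := by
      rw [hp.inner _ hjn _ hjn, chainGram, if_pos rfl, mul_one]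
    have hpp' : ⟪p (j + 1), cascStar K (p (j + 1))⟫ = 0 := by
      rw [hp.inner_star _ hjn _ hjn]
      simp
    have hap' : ⟪a, p (j + 1)⟫ = 0 := by
      rw [hap _ hjn]
      simp
    have hasp' := hasp _ hjn
    have hss : ∀ {x y q r : V} , ⟪q + r, x + y⟫ = ⟪q, x⟫ + ⟪q, y⟫ + ⟪r, x⟫ + ⟪r, y⟫ := by
      intro x y q r
      rw [inner_add_left, inner_add_right, inner_add_right]
      ring
    have e1 : ⟪W, a + cascStar K a⟫ = -c := by rw [inner_add_right, hWa, hWa']; ring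
    have e2 : ⟪W, p (j + 1) + cascStar K (p (j + 1))⟫ = -c := by
      rw [inner_add_right, hWp, hWp']; ring
    have e3 : ⟪a + cascStar K a, a + cascStar K a⟫ = 2 * c := by
      rw [hss, hK.inner_cascStar_cascStar, hK.inner_cascStar_comm, haa, has]; ring
    have e4 : ⟪p (j + 1) + cascStar K (p (j + 1)), p (j + 1) + cascStar K (p (j + 1))⟫ = 2 * c := by
      rw [hss, hK.inner_cascStar_cascStar, hK.inner_cascStar_comm, hpp, hpp']; ring
    have e5 : ⟪a + cascStar K a, p (j + 1) + cascStar K (p (j + 1))⟫ = 0 := by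
      rw [hss, hK.inner_cascStar_cascStar, hK.inner_cascStar_comm, hap', hasp']; ring
    have hv : (2 : ℝ) • W + (a + cascStar K a) + (p (j + 1) + cascStar K (p (j + 1))) = 0 := by
      rw [← inner_self_eq_zero (𝕜 := ℝ), real_inner_add_add_self, real_inner_add_add_self,
        inner_add_left ((2 : ℝ) • W), real_inner_smul_left, real_inner_smul_left,
        real_inner_smul_left, real_inner_smul_right, hWW, e1, e2, e3, e4, e5]
      ring
    have h1 := ctx.inner_rho_nonneg (hp.chainSum_mem hK hj)
    have h2 := ctx.one_le_inner_rho (ctx.base_subset ha)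
    have h3 := ctx.one_le_inner_rho (hK.cascStar_mem_pos (ctx.base_subset ha))
    have h4 := ctx.one_le_inner_rho (ctx.base_subset (hp.mem _ hjn))
    have h5 := ctx.one_le_inner_rho (hK.cascStar_mem_pos (ctx.base_subset (hp.mem _ hjn)))
    have h6 := congrArg (fun v => ⟪v, ctx.rho⟫) hv
    simp only [inner_add_left, real_inner_smul_left, inner_zero_left] at h6
    linarith
  subst hjn
  refine ⟨fun i hi => ?_, fun i hi k hk => ?_, fun i hi k hk => ?_⟩
  · split_ifs with h
    · exact hp.mem i h
    · exact ha
  · by_cases h : i < j + 1 <;> by_cases h' : k < j + 1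
    · simp only [h, h', if_true]
      exact hp.inner i h k h'
    · simp only [h, h', if_true, if_false]
      rw [real_inner_comm, hap i h, chainGram]
      congr 1
      split_ifs <;> first | omega | rfl
    · simp only [h, h', if_true, if_false]
      rw [hap k h', chainGram]
      congr 1
      split_ifs <;> first | omega | rfl
    · simp only [h, h', if_false]
      rw [haa, chainGram, if_pos (by omega), mul_one]
  · by_cases h : i < j + 1 <;> by_cases h' : k < j + 1
    · simp only [h, h', if_true]
      exact hp.inner_star i h k h'
    · simp only [h, h', if_true, if_false]
      rw [← hK.inner_cascStar_comm, real_inner_comm, hasp i h, if_neg (by omega), mul_zero]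
    · simp only [h, h', if_true, if_false]
      rw [hasp k h', if_neg (by omega), mul_zero]
    · simp only [h, h', if_false]
      rw [has, if_neg (by omega), mul_zero]

end Chain

end RootSystemCtx

namespace RootSystemCtx

section ChainExtension

variable {V : Type*} [NormedAddCommGroup V] [InnerProductSpace ℝ V] [FiniteDimensional ℝ V]
  {ctx : RootSystemCtx V} {K : Finset V} (hK : ctx.IsCascade K) {c : ℝ} {n : ℕ} {p : ℕ → V}
include hK

lemma IsHalfChain.ne_of_inner (hp : ctx.IsHalfChain K c n p) {a : V} (hc : 0 < c)
    (ha : a ∈ ctx.base) (ha' : ∀ i < n, a ≠ p i ∧ a ≠ cascStar K (p i)) :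
    (∀ i < n, ⟪a, p i⟫ ≤ 0 ∧ ⟪a, cascStar K (p i)⟫ ≤ 0) ∧
    ∀ i, ∃ x y x' y' : ℤ, i < n →
      (0 ≤ x ∧ c * x = -2 * ⟪a, p i⟫) ∧ (0 ≤ y ∧ c * y = -2 * ⟪a, cascStar K (p i)⟫) ∧
      ⟪a, a⟫ * x' = -2 * ⟪a, p i⟫ ∧ ⟪a, a⟫ * y' = -2 * ⟪a, cascStar K (p i)⟫ := by
  have hnp : ∀ i < n, ⟪a, p i⟫ ≤ 0 ∧ ⟪a, cascStar K (p i)⟫ ≤ 0 := fun i hi =>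
    ⟨ctx.inner_base_nonpos ha (hp.mem i hi) (ha' i hi).1,
      ctx.inner_base_nonpos ha (hK.cascStar_mem_base (hp.mem i hi)) (ha' i hi).2⟩
  refine ⟨hnp, fun i => ?_⟩
  by_cases hi : i < n
  swap
  · exact ⟨0, 0, 0, 0, fun h => absurd h hi⟩
  have haΔ := ctx.base_mem ha
  have hpΔ := ctx.base_mem (hp.mem i hi)
  have hsΔ := ctx.base_mem (hK.cascStar_mem_base (hp.mem i hi))
  have hpp : ⟪p i, p i⟫ = c := by rw [hp.inner i hi i hi, chainGram, if_pos rfl, mul_one]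
  obtain ⟨x, hx⟩ := ctx.pairing_int _ hpΔ a haΔ
  obtain ⟨y, hy⟩ := ctx.pairing_int _ hsΔ a haΔ
  obtain ⟨x', hx'⟩ := ctx.pairing_int a haΔ _ hpΔ
  obtain ⟨y', hy'⟩ := ctx.pairing_int a haΔ _ hsΔ
  have h1 := ctx.pairing_mul_self (γ := a) hpΔ
  have h2 := ctx.pairing_mul_self (γ := a) hsΔ
  have h3 := ctx.pairing_mul_self (γ := p i) haΔ
  have h4 := ctx.pairing_mul_self (γ := cascStar K (p i)) haΔ
  rw [hx, hpp] at h1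
  rw [hy, hK.inner_cascStar_cascStar, hpp] at h2
  rw [hx', real_inner_comm a (p i)] at h3
  rw [hy', real_inner_comm a (cascStar K (p i))] at h4
  have h5 := hnp i hi
  refine ⟨-x, -y, -x', -y', fun _ => ⟨⟨?_, ?_⟩, ⟨?_, ?_⟩, ?_, ?_⟩⟩
  · have : (x : ℝ) ≤ 0 := by nlinarith
    have : x ≤ 0 := by exact_mod_cast this
    omega
  · push_cast; linarith
  · have : (y : ℝ) ≤ 0 := by nlinarith
    have : y ≤ 0 := by exact_mod_cast this
    omega
  · push_cast; linarith
  · push_cast; linarith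
  · push_cast; linarith

/-- A half-chain which does not exhaust the base extends to a longer one. -/
lemma IsHalfChain.extend (hp : ctx.IsHalfChain K c n p) (hc : 0 < c) (hn : 1 ≤ n)
    (hex : ∃ a ∈ ctx.base, ∀ i < n, a ≠ p i ∧ a ≠ cascStar K (p i)) :
    ∃ p', ctx.IsHalfChain K c (n + 1) p' := by
  obtain ⟨a₀, ha₀, ha₀'⟩ := hex
  let B := (Finset.range n).image p ∪ (Finset.range n).image (fun i => cascStar K (p i))
  have hB : ∀ b, b ∈ B ↔ ∃ i < n, b = p i ∨ b = cascStar K (p i) := by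
    intro b
    simp only [B, Finset.mem_union, Finset.mem_image, Finset.mem_range]
    constructor
    · rintro (⟨i, hi, rfl⟩ | ⟨i, hi, rfl⟩)
      · exact ⟨i, hi, Or.inl rfl⟩
      · exact ⟨i, hi, Or.inr rfl⟩
    · rintro ⟨i, hi, rfl | rfl⟩
      · exact Or.inl ⟨i, hi, rfl⟩
      · exact Or.inr ⟨i, hi, rfl⟩
  have hBb : B ⊆ ctx.base := by
    intro b hb
    obtain ⟨i, hi, rfl | rfl⟩ := (hB b).1 hb
    · exact hp.mem i hi
    · exact hK.cascStar_mem_base (hp.mem i hi)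
  obtain ⟨a, ha, haB, b, hb, hab⟩ := ctx.exists_base_inner_ne hBb
    ⟨p 0, (hB _).2 ⟨0, hn, Or.inl rfl⟩⟩ ⟨a₀, ha₀, fun h => by
      obtain ⟨i, hi, h⟩ := (hB _).1 h
      rcases h with h | h
      · exact (ha₀' i hi).1 h
      · exact (ha₀' i hi).2 h⟩
  have ha' : ∀ i < n, a ≠ p i ∧ a ≠ cascStar K (p i) := fun i hi =>
    ⟨fun h => haB ((hB _).2 ⟨i, hi, Or.inl h⟩), fun h => haB ((hB _).2 ⟨i, hi, Or.inr h⟩)⟩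
  obtain ⟨hnp, hxy⟩ := hp.ne_of_inner hK hc ha ha'
  choose x y x' y' hxy using hxy
  have hN := ctx.inner_self_pos (ctx.base_mem ha)
  obtain ⟨k, rfl⟩ : ∃ k, n = k + 1 := ⟨n - 1, by omega⟩
  set T := chainSum K p (k + 1) with hT
  have hTT : ⟪T, T⟫ = c := hp.inner_chainSum_self hK le_rfl
  have hTs : cascStar K T = T := cascStar_chainSum hK _
  have haT : ⟪a, T⟫ = ∑ i ∈ Finset.range (k + 1), (⟪a, p i⟫ + ⟪a, cascStar K (p i)⟫) := by
    rw [hT, chainSum, inner_sum]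
    exact Finset.sum_congr rfl fun i _ => inner_add_right _ _ _
  have haT0 : ⟪a, T⟫ < 0 := by
    obtain ⟨i, hi, h⟩ := (hB b).1 hb
    rw [haT]
    refine Finset.sum_neg' (fun j hj => ?_) ⟨i, Finset.mem_range.2 hi, ?_⟩
    · have := hnp j (Finset.mem_range.1 hj)
      linarith
    · have := hnp i hi
      rcases h with rfl | rfl
      · have := lt_of_le_of_ne this.1 hab
        linarith
      · have := lt_of_le_of_ne this.2 hab
        linarith
  have hvpos : ∀ (r : ℝ) (w : V), 0 ≤ r → w ∈ AddSubmonoid.closure (ctx.base : Set V) →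
      0 < ⟪a + w + r • T, a + w + r • T⟫ := by
    intro r w hr hw
    refine real_inner_self_pos.2 fun h0 => ?_
    have h1 := ctx.inner_rho ha
    have h2 := ctx.inner_rho_nonneg (hp.chainSum_mem hK le_rfl)
    have h3 := ctx.inner_rho_nonneg hw
    have h4 := congrArg (fun v => ⟪v, ctx.rho⟫) h0
    simp only [inner_add_left, real_inner_smul_left, inner_zero_left] at h4
    nlinarith [mul_nonneg hr h2]
  have hnorm : ∀ (r : ℝ) (w : V), ⟪a + w + r • T, a + w + r • T⟫ =
      ⟪a + w, a + w⟫ + 2 * r * (⟪a, T⟫ + ⟪w, T⟫) + r ^ 2 * c := by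
    intro r w
    rw [real_inner_add_add_self, real_inner_smul_right, real_inner_smul_left,
      real_inner_smul_right, hTT, inner_add_left a w T]
    ring
  by_cases hfix : cascStar K a = a
  · exfalso
    have hsw : ∀ i, ⟪a, cascStar K (p i)⟫ = ⟪a, p i⟫ := fun i => by
      rw [← hK.inner_cascStar_comm, hfix]
    have hY : c * (∑ i ∈ Finset.range (k + 1), x i : ℤ) = -⟪a, T⟫ := by
      rw [haT, Int.cast_sum, Finset.mul_sum, ← Finset.sum_neg_distrib]
      refine Finset.sum_congr rfl fun i hi => ?_
      rw [(hxy i (Finset.mem_range.1 hi)).1.2, hsw]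
      ring
    have hM : ⟪a, a⟫ * (∑ i ∈ Finset.range (k + 1), x' i : ℤ) = -⟪a, T⟫ := by
      rw [haT, Int.cast_sum, Finset.mul_sum, ← Finset.sum_neg_distrib]
      refine Finset.sum_congr rfl fun i hi => ?_
      rw [(hxy i (Finset.mem_range.1 hi)).2.2.1, hsw]
      ring
    generalize (∑ i ∈ Finset.range (k + 1), x i : ℤ) = Y at hY
    generalize (∑ i ∈ Finset.range (k + 1), x' i : ℤ) = M at hM
    have hY1 : (1 : ℝ) ≤ Y := by
      have : (0 : ℝ) < Y := by by_contra! h; nlinarith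
      have : 0 < Y := by exact_mod_cast this
      exact_mod_cast this
    have hM1 : (1 : ℝ) ≤ M := by
      have : (0 : ℝ) < M := by by_contra! h; nlinarith
      have : 0 < M := by exact_mod_cast this
      exact_mod_cast this
    have h1 := hvpos Y 0 (by linarith) (zero_mem _)
    rw [hnorm, inner_zero_left, add_zero, add_zero] at h1
    have h2 : ⟪a, a⟫ * M * Y = c * Y * Y := by rw [hM, hY]
    have h3 : 1 ≤ (M : ℝ) * Y := one_le_mul_of_one_le_of_one_le hM1 hY1
    have h4 : ⟪a, T⟫ = -(c * Y) := by linarith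
    rw [h4] at h1
    nlinarith
  have hsa := hK.cascStar_mem_base ha
  have hX : c * (∑ i ∈ Finset.range (k + 1), (x i + y i) : ℤ) = -2 * ⟪a, T⟫ := by
    rw [haT, Int.cast_sum, Finset.mul_sum, Finset.mul_sum]
    refine Finset.sum_congr rfl fun i hi => ?_
    have := hxy i (Finset.mem_range.1 hi)
    push_cast
    rw [mul_add, this.1.2, this.2.1.2]
    ring
  have hM : ⟪a, a⟫ * (∑ i ∈ Finset.range (k + 1), (x' i + y' i) : ℤ) = -2 * ⟪a, T⟫ := by
    rw [haT, Int.cast_sum, Finset.mul_sum, Finset.mul_sum]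
    refine Finset.sum_congr rfl fun i hi => ?_
    have := hxy i (Finset.mem_range.1 hi)
    push_cast
    rw [mul_add, this.2.2.1, this.2.2.2]
    ring
  generalize hXd : (∑ i ∈ Finset.range (k + 1), (x i + y i) : ℤ) = X at hX
  generalize (∑ i ∈ Finset.range (k + 1), (x' i + y' i) : ℤ) = M at hM
  have hX1 : 1 ≤ X := by
    have : (0 : ℝ) < X := by by_contra! h; nlinarith
    exact_mod_cast this
  have hM1 : 1 ≤ M := by
    have : (0 : ℝ) < M := by by_contra! h; nlinarith
    exact_mod_cast this
  have hXr : (1 : ℝ) ≤ X := by exact_mod_cast hX1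
  have hMr : (1 : ℝ) ≤ M := by exact_mod_cast hM1
  have hq := ctx.inner_base_nonpos ha hsa (Ne.symm hfix)
  have hsaT : ⟪cascStar K a, T⟫ = ⟪a, T⟫ := by rw [hK.inner_cascStar_comm, hTs]
  have hsasa : ⟪cascStar K a, cascStar K a⟫ = ⟪a, a⟫ := hK.inner_cascStar_cascStar a a
  have hineq : ⟪a, a⟫ * (M * X) < 2 * ⟪a, a⟫ + 2 * ⟪a, cascStar K a⟫ := by
    have h1 := hvpos X (cascStar K a) (by linarith) (AddSubmonoid.subset_closure hsa)
    rw [hnorm, hsaT, real_inner_add_add_self, hsasa] at h1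
    have h2 : ⟪a, a⟫ * M * X = c * X * X := by rw [hM, hX]
    have h4 : ⟪a, T⟫ = -(c * X) / 2 := by linarith
    rw [h4] at h1
    nlinarith
  have hMX : M * X = 1 := by
    have h1 : ((M * X : ℤ) : ℝ) < 2 := by
      push_cast
      by_contra! h
      nlinarith
    have h2 : M * X < 2 := by exact_mod_cast h1
    nlinarith
  have hXe : X = 1 := by nlinarith
  have hMe : M = 1 := by nlinarith
  subst hXe hMe
  have hNc : ⟪a, a⟫ = c := by
    push_cast at hX hM
    linarith
  have hq0 : ⟪a, cascStar K a⟫ = 0 := by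
    obtain ⟨z, hz⟩ := ctx.pairing_int a (ctx.base_mem ha) _ (ctx.base_mem hsa)
    have h1 := ctx.pairing_mul_self (γ := cascStar K a) (ctx.base_mem ha)
    rw [hz, real_inner_comm a (cascStar K a)] at h1
    push_cast at hineq
    have h2 : (-1 : ℝ) < z := by by_contra! h; nlinarith
    have h3 : (z : ℝ) < 1 := by by_contra! h; nlinarith
    have h2' : -1 < z := by exact_mod_cast h2
    have h3' : z < 1 := by exact_mod_cast h3
    have h4 : z = 0 := by omega
    rw [h4, Int.cast_zero, zero_mul] at h1
    linarith
  have hxn : ∀ i ∈ Finset.range (k + 1), 0 ≤ x i + y i := fun i hi => by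
    have := hxy i (Finset.mem_range.1 hi)
    linarith [this.1.1, this.2.1.1]
  obtain ⟨j, hj, hj0⟩ := Finset.exists_ne_zero_of_sum_ne_zero (by rw [hXd]; norm_num)
  have hsplit := Finset.add_sum_erase _ (fun i => x i + y i) hj
  rw [hXd] at hsplit
  have hrest := Finset.sum_nonneg fun i (hi : i ∈ (Finset.range (k + 1)).erase j) =>
    hxn i (Finset.mem_of_mem_erase hi)
  have hj1 : x j + y j = 1 := by
    have := hxn j hj
    omega
  have hrest0 : ∀ i < k + 1, i ≠ j → x i = 0 ∧ y i = 0 := by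
    intro i hi hij
    have h0 : ∑ i ∈ (Finset.range (k + 1)).erase j, (x i + y i) = 0 := by omega
    have h1 := (Finset.sum_eq_zero_iff_of_nonneg fun i hi => hxn i (Finset.mem_of_mem_erase hi)).1 h0
      i (Finset.mem_erase.2 ⟨hij, Finset.mem_range.2 hi⟩)
    have h2 := hxy i hi
    have h3 := h2.1.1
    have h4 := h2.2.1.1
    omega
  have hjk := Finset.mem_range.1 hj
  have hval : ∀ {q : ℝ} {z : ℤ}, c * z = -2 * q → q = c * (-(z : ℝ) / 2) := by
    intro q z h
    linarith
  have hv1 : ∀ i < k + 1, ⟪a, p i⟫ = c * (-(x i : ℝ) / 2) := fun i hi => hval (hxy i hi).1.2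
  have hv2 : ∀ i < k + 1, ⟪a, cascStar K (p i)⟫ = c * (-(y i : ℝ) / 2) := fun i hi =>
    hval (hxy i hi).2.1.2
  have hxj := (hxy j hjk).1.1
  have hyj := (hxy j hjk).2.1.1
  have hcase : (x j = 1 ∧ y j = 0) ∨ (x j = 0 ∧ y j = 1) := by omega
  rcases hcase with ⟨h1, h2⟩ | ⟨h1, h2⟩
  · refine ⟨_, hp.snoc hK hjk ha hNc hq0 (fun i hi => ?_) (fun i hi => ?_)⟩
    · rw [hv1 i hi]
      by_cases hij : i = j
      · rw [hij, h1, if_pos rfl]; norm_num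
      · rw [(hrest0 i hi hij).1, if_neg hij]; norm_num
    · rw [hv2 i hi]
      by_cases hij : i = j
      · rw [hij, h2]; norm_num
      · rw [(hrest0 i hi hij).2]; norm_num
  · refine ⟨_, hp.snoc hK hjk hsa (hsasa.trans hNc) ?_ (fun i hi => ?_) (fun i hi => ?_)⟩
    · rw [hK.cascStar_cascStar, real_inner_comm, hq0]
    · rw [hK.inner_cascStar_comm, hv2 i hi]
      by_cases hij : i = j
      · rw [hij, h2, if_pos rfl]; norm_num
      · rw [(hrest0 i hi hij).2, if_neg hij]; norm_num
    · rw [hK.inner_cascStar_cascStar, hv1 i hi]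
      by_cases hij : i = j
      · rw [hij, h1]; norm_num
      · rw [(hrest0 i hi hij).1]; norm_num

end ChainExtension

end RootSystemCtx

namespace RootSystemCtx

section Integrality

variable {V : Type*} [NormedAddCommGroup V] [InnerProductSpace ℝ V] [FiniteDimensional ℝ V]
  {ctx : RootSystemCtx V} {K : Finset V} (hK : ctx.IsCascade K) {c : ℝ} {n : ℕ} {p : ℕ → V}

lemma chainGram_eq_one_iff {i j : ℕ} : chainGram i j = 1 ↔ i = j := by
  unfold chainGram
  constructor
  · intro h
    split_ifs at h
    · assumption
    · norm_num at h
    · norm_num at h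
  · rintro rfl
    simp

omit [FiniteDimensional ℝ V] in
lemma IsHalfChain.le_card (hp : ctx.IsHalfChain K c n p) (hc : 0 < c) : n ≤ ctx.base.card := by
  rw [← Finset.card_range n]
  refine Finset.card_le_card_of_injOn p (fun i hi => hp.mem i (Finset.mem_range.1 hi)) ?_
  intro i hi j hj hij
  have hi := Finset.mem_range.1 hi
  have hj := Finset.mem_range.1 hj
  have h1 := hp.inner i hi i hi
  nth_rewrite 2 [hij] at h1
  rw [hp.inner i hi j hj, chainGram_eq_one_iff.2 rfl] at h1
  exact chainGram_eq_one_iff.1 (mul_left_cancel₀ hc.ne' h1)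

include hK

/-- A half-chain exhausting the base exhibits the root system as of type `A₂ₙ`. -/
lemma IsHalfChain.isTypeA (hp : ctx.IsHalfChain K c n p) (hc : 0 < c) (hn : 1 ≤ n)
    (hall : ∀ a ∈ ctx.base, ∃ i < n, a = p i ∨ a = cascStar K (p i)) : ctx.IsTypeA (2 * n) := by
  let f : ℕ → V := fun i => if i < n then p (n - 1 - i) else cascStar K (p (i - n))
  have hf : ∀ i < 2 * n, f i ∈ ctx.base := by
    intro i hi
    simp only [f]
    split_ifs with h
    · exact hp.mem _ (by omega)
    · exact hK.cascStar_mem_base (hp.mem _ (by omega))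
  have hinner : ∀ i < 2 * n, ∀ j < 2 * n, ⟪f i, f j⟫ = c * chainGram i j := by
    intro i hi j hj
    simp only [f]
    by_cases h : i < n <;> by_cases h' : j < n
    · simp only [h, h', if_true]
      rw [hp.inner _ (by omega) _ (by omega), chainGram, chainGram]
      congr 1
      split_ifs <;> first | omega | rfl
    · simp only [h, h', if_true, if_false]
      rw [hp.inner_star _ (by omega) _ (by omega), chainGram]
      congr 1
      split_ifs <;> first | omega | rfl
    · simp only [h, h', if_true, if_false]
      rw [hp.inner_star' hK (by omega) (by omega), chainGram]
      congr 1
      split_ifs <;> first | omega | rfl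
    · simp only [h, h', if_false]
      rw [hK.inner_cascStar_cascStar, hp.inner _ (by omega) _ (by omega), chainGram, chainGram]
      congr 1
      split_ifs <;> first | omega | rfl
  let F : Fin (2 * n) → {x // x ∈ ctx.base} := fun i => ⟨f i, hf i i.2⟩
  have hF : Function.Bijective F := by
    constructor
    · intro i j hij
      have hij : f i = f j := congrArg Subtype.val hij
      have h1 := hinner i i.2 i i.2
      nth_rewrite 2 [hij] at h1
      rw [hinner i i.2 j j.2, chainGram_eq_one_iff.2 rfl] at h1
      exact Fin.ext (chainGram_eq_one_iff.1 (mul_left_cancel₀ hc.ne' h1))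
    · rintro ⟨a, ha⟩
      obtain ⟨i, hi, h | h⟩ := hall a ha
      · refine ⟨⟨n - 1 - i, by omega⟩, Subtype.ext ?_⟩
        change f (n - 1 - i) = a
        simp only [f]
        rw [if_pos (by omega), h]
        congr 1
        omega
      · refine ⟨⟨n + i, by omega⟩, Subtype.ext ?_⟩
        change f (n + i) = a
        simp only [f]
        rw [if_neg (by omega), h]
        congr 2
        omega
  refine ⟨by omega, Equiv.ofBijective F hF, fun i j => ?_⟩
  change cartanPairing (f i) (f j) = _
  rw [cartanPairing, hinner i i.2 j j.2, hinner j j.2 j j.2, chainGram_eq_one_iff.2 rfl, chainGram]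
  have hc' := hc.ne'
  simp only [Fin.ext_iff]
  split_ifs <;> field_simp
  norm_num

/-- Unless the type is `A₂ₚ`, the opposition does not send a simple root to an adjacent one. -/
lemma IsCascade.cascStar_eq_or_orthogonal (hA : ¬ ∃ p, 1 ≤ p ∧ ctx.IsTypeA (2 * p)) {α : V}
    (hα : α ∈ ctx.base) :
    cascStar K α = α ∨ cascStar K α ≠ α ∧ ⟪cascStar K α, α⟫ = 0 := by
  by_contra! hcon
  obtain ⟨hne, h0⟩ := hcon
  have h0 := h0 hne
  have hs := hK.cascStar_mem_base hα
  have hαΔ := ctx.base_mem hα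
  have hsΔ := ctx.base_mem hs
  have hc := ctx.inner_self_pos hαΔ
  have hle := ctx.inner_base_nonpos hs hα hne
  have hss : ⟪cascStar K α, cascStar K α⟫ = ⟪α, α⟫ := hK.inner_cascStar_cascStar α α
  obtain ⟨z, hz⟩ := ctx.pairing_int _ hαΔ _ hsΔ
  have hz' : cartanPairing α (cascStar K α) = z := by
    rw [← hz, cartanPairing, cartanPairing, hss, real_inner_comm (cascStar K α) α]
  have h1 := ctx.pairing_mul_self (γ := cascStar K α) hαΔ
  rw [hz] at h1
  have hzneg : z ≤ -1 := by
    have : (z : ℝ) < 0 := by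
      have := lt_of_le_of_ne hle h0
      by_contra! h
      nlinarith
    have : z < 0 := by exact_mod_cast this
    omega
  have hz2 : z = -1 := by
    have h2 := ctx.pairing_mul_le hαΔ hsΔ
    rw [hz, hz'] at h2
    have h3 : z * z ≤ 4 := by exact_mod_cast h2
    have h4 : -2 ≤ z := by nlinarith
    rcases (show z = -2 ∨ z = -1 by omega) with h5 | h5
    · exfalso
      have h6 := ctx.eq_smul_of_pairing_mul hαΔ hsΔ (by rw [hz, hz', h5]; norm_num)
      rw [hz', h5] at h6
      have h7 := ctx.inner_rho hα
      have h8 := ctx.inner_rho hs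
      have h9 := congrArg (fun v => ⟪v, ctx.rho⟫) h6
      simp only [real_inner_smul_left, h7, h8] at h9
      norm_num at h9
    · exact h5
  rw [hz2] at h1
  have hbase : ctx.IsHalfChain K ⟪α, α⟫ 1 (fun _ => α) := by
    refine ⟨fun _ _ => hα, fun i hi j hj => ?_, fun i hi j hj => ?_⟩
    · rw [chainGram, if_pos (by omega), mul_one]
    · rw [if_pos (by omega), real_inner_comm]
      push_cast at h1
      linarith
  have hall : ∀ m, ∃ p, ctx.IsHalfChain K ⟪α, α⟫ (m + 1) p := by
    intro m
    induction m with
    | zero => exact ⟨_, hbase⟩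
    | succ m ih =>
      obtain ⟨p, hp⟩ := ih
      refine hp.extend hK hc (by omega) ?_
      by_contra! hcon
      refine hA ⟨m + 1, by omega, hp.isTypeA hK hc (by omega) fun a ha => ?_⟩
      obtain ⟨i, hi, h⟩ := hcon a ha
      exact ⟨i, hi, or_iff_not_imp_left.2 h⟩
  obtain ⟨p, hp⟩ := hall ctx.base.card
  have := hp.le_card hc
  omega

/-- Unless the type is `A₂ₚ`, all roots take integral values on the cascade element. -/
lemma IsCascade.inner_cascElt_int (hred : ∀ γ ∈ ctx.Δ, (2 : ℝ) • γ ∉ ctx.Δ)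
    (hA : ¬ ∃ p, 1 ≤ p ∧ ctx.IsTypeA (2 * p)) {γ : V} (hγ : γ ∈ ctx.Δ) :
    ∃ k : ℤ, ⟪γ, cascElt K⟫ = k := by
  have hcl : ∀ v ∈ AddSubmonoid.closure (ctx.base : Set V), ∃ k : ℤ, ⟪v, cascElt K⟫ = k := by
    intro v hv
    induction hv using AddSubmonoid.closure_induction with
    | mem α hα =>
      obtain ⟨k, hk⟩ := hK.even_sum_pairing hred hα (hK.cascStar_eq_or_orthogonal hA hα)
      refine ⟨k, ?_⟩
      have : (2 : ℝ) * ⟪α, cascElt K⟫ = 2 * k := by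
        rw [← hk, cascElt, inner_sum, Finset.mul_sum]
        refine Finset.sum_congr rfl fun β _ => ?_
        rw [real_inner_smul_right, cartanPairing]
        ring
      linarith
    | zero => exact ⟨0, by simp⟩
    | add x y _ _ hx hy =>
      obtain ⟨a, ha⟩ := hx
      obtain ⟨b, hb⟩ := hy
      exact ⟨a + b, by rw [inner_add_left, ha, hb]; push_cast; rfl⟩
  rcases ctx.mem_closure_or hγ with h | h
  · exact hcl γ h
  · obtain ⟨k, hk⟩ := hcl _ h
    exact ⟨-k, by rw [inner_neg_left] at hk; push_cast; linarith⟩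


end Integrality

end RootSystemCtx

section GradedOperators

open Module

variable {M : Type*} [AddCommGroup M] [Module ℂ M]

lemma End.mapsTo_eigenspace_of_commutator {H E : End ℂ M} {c : ℂ} (h : H * E - E * H = c • E)
    {μ : ℂ} {v : M} (hv : v ∈ H.eigenspace μ) : E v ∈ H.eigenspace (μ + c) := by
  rw [End.mem_eigenspace_iff] at hv ⊢
  have := congrArg (· v) h
  simp only [LinearMap.sub_apply, End.mul_apply, LinearMap.smul_apply, hv, map_smul] at this
  rw [add_smul, ← this]
  abel

variable [FiniteDimensional ℂ M]

lemma Submodule.map_eq_of_injective {A : End ℂ M} {p : Submodule ℂ M} (hp : ∀ v ∈ p, A v ∈ p)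
    (hinj : ∀ v ∈ p, A v = 0 → v = 0) : p.map A = p := by
  refine Submodule.eq_of_le_of_finrank_eq (Submodule.map_le_iff_le_comap.2 hp) ?_
  have h := LinearMap.finrank_range_of_inj (f := A.domRestrict p) (by
    rw [injective_iff_map_eq_zero]
    intro v hv
    exact Subtype.ext (hinj v v.2 hv))
  rwa [LinearMap.range_domRestrict] at h

/-- In a representation of `sl₂`, raising after lowering is bijective on positive weight spaces. -/
lemma map_raise_lower {H E F : End ℂ M} (hE : H * E - E * H = (2 : ℂ) • E)
    (hF : H * F - F * H = (-2 : ℂ) • F) (hEF : E * F - F * E = H) (hn : IsNilpotent E)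
    {k : ℤ} (hk : 1 ≤ k) :
    (H.eigenspace (2 * k : ℂ)).map (E * F) = H.eigenspace (2 * k : ℂ) := by
  apply Submodule.map_eq_of_injective
  · intro v hv
    have := End.mapsTo_eigenspace_of_commutator hE (End.mapsTo_eigenspace_of_commutator hF hv)
    rwa [neg_add_cancel_right] at this
  intro v hv h0
  have hv' : ∀ j : ℕ, (E ^ j) v ∈ H.eigenspace (2 * (k + j) : ℂ) := by
    intro j
    induction j with
    | zero => simpa using hv
    | succ j ih =>
      have := End.mapsTo_eigenspace_of_commutator hE ih
      rw [pow_succ', End.mul_apply]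
      convert this using 2
      push_cast
      ring
  have hc : ∀ j : ℕ, ∃ c : ℝ, c < 0 ∧ F ((E ^ (j + 1)) v) = (c : ℂ) • (E ^ j) v := by
    have key (j : ℕ) (c : ℝ) (h : E (F ((E ^ j) v)) = (c : ℂ) • (E ^ j) v) :
        F ((E ^ (j + 1)) v) = ((c - 2 * (k + j) : ℝ) : ℂ) • (E ^ j) v := by
      have h1 := congrArg (· ((E ^ j) v)) hEF
      simp only [LinearMap.sub_apply, End.mul_apply] at h1
      rw [End.mem_eigenspace_iff.1 (hv' j), h] at h1
      rw [pow_succ', End.mul_apply]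
      push_cast
      rw [sub_smul, ← h1]
      abel
    have hk1 : (1 : ℝ) ≤ k := by exact_mod_cast hk
    intro j
    induction j with
    | zero => exact ⟨_, by push_cast; linarith, key 0 0 (by simpa using h0)⟩
    | succ j ih =>
      obtain ⟨c, hc, h⟩ := ih
      refine ⟨_, ?_, key (j + 1) c (by rw [h, map_smul, pow_succ' E j, End.mul_apply])⟩
      have : (0 : ℝ) ≤ ((j + 1 : ℕ) : ℝ) := by positivity
      linarith
  obtain ⟨N, hN⟩ := hn
  have hz : ∀ j, (E ^ j) v = 0 → v = 0 := by
    intro j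
    induction j with
    | zero => simp
    | succ j ih =>
      intro h
      obtain ⟨c, hc, h'⟩ := hc j
      rw [h, map_zero] at h'
      rcases smul_eq_zero.1 h'.symm with h'' | h''
      · exact absurd (by exact_mod_cast h'') hc.ne
      · exact ih h''
  exact hz N (by rw [hN]; rfl)

/-- If the weights of a representation of `sl₂` are even, the kernel of the raising operator has
the dimension of the zero weight space. -/
lemma finrank_ker_raise {H E F : End ℂ M} (hE : H * E - E * H = (2 : ℂ) • E)
    (hF : H * F - F * H = (-2 : ℂ) • F) (hEF : E * F - F * E = H) (hnE : IsNilpotent E)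
    (hnF : IsNilpotent F) (htop : ⨆ k : ℤ, H.eigenspace (2 * k : ℂ) = ⊤) :
    finrank ℂ (LinearMap.ker E) = finrank ℂ (LinearMap.ker H) := by
  set W : ℤ → Submodule ℂ M := fun k => H.eigenspace (2 * k : ℂ) with hW
  have hWE {k : ℤ} {v : M} (hv : v ∈ W k) : E v ∈ W (k + 1) := by
    have := End.mapsTo_eigenspace_of_commutator hE hv
    simp only [hW]
    push_cast
    rwa [mul_add, mul_one]
  have hWF {k : ℤ} {v : M} (hv : v ∈ W k) : F v ∈ W (k - 1) := by
    have := End.mapsTo_eigenspace_of_commutator hF hv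
    simp only [hW]
    push_cast
    rwa [mul_sub, mul_one, sub_eq_add_neg]
  have hind : iSupIndep W := (End.eigenspaces_iSupIndep H).comp (f := fun k : ℤ => (2 * k : ℂ))
    (fun a b h => by simpa using h)
  have hup (k : ℤ) (hk : 0 ≤ k) : (W k).map E = W (k + 1) := by
    apply le_antisymm
    · rintro _ ⟨v, hv, rfl⟩
      exact hWE hv
    · intro v hv
      have h := map_raise_lower hE hF hEF hnE (k := k + 1) (by omega)
      change (W (k + 1)).map (E * F) = W (k + 1) at h
      obtain ⟨u, hu, rfl⟩ := (show v ∈ (W (k + 1)).map (E * F) from h.symm ▸ hv)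
      have := hWF hu
      rw [add_sub_cancel_right] at this
      exact ⟨F u, this, rfl⟩
  have hdown (k : ℤ) (hk : k ≤ -1) : (W k).map (F * E) = W k := by
    have h := map_raise_lower (H := -H) (E := F) (F := E)
      (by rw [← sub_eq_zero] at hF ⊢; rw [← neg_eq_zero.2 hF]; simp; abel)
      (by rw [← sub_eq_zero] at hE ⊢; rw [← neg_eq_zero.2 hE]; simp; abel)
      (by rw [← hEF]; abel) hnF (k := -k) (by omega)
    have h2 : (-H).eigenspace (2 * ((-k : ℤ) : ℂ)) = W k := by
      ext v
      simp only [hW, End.mem_eigenspace_iff, LinearMap.neg_apply, Int.cast_neg, mul_neg, neg_smul,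
        neg_inj]
    rwa [h2] at h
  set N : Submodule ℂ M := ⨆ k ∈ {k : ℤ | 0 ≤ k}, W k with hN
  set N₁ : Submodule ℂ M := ⨆ k ∈ {k : ℤ | 1 ≤ k}, W k with hN₁
  set N' : Submodule ℂ M := ⨆ k ∈ {k : ℤ | k ≤ -1}, W k with hN'
  have hd : Disjoint N N' := hind.disjoint_biSup_biSup (Set.disjoint_left.2 fun k h h' => by
    simp only [Set.mem_ofPred_eq] at h h'; omega)
  have hsum : N ⊔ N' = ⊤ := by
    rw [eq_top_iff, ← htop]
    refine iSup_le fun k => ?_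
    rcases le_or_gt 0 k with h | h
    · exact (le_biSup W (show k ∈ {k : ℤ | 0 ≤ k} from h)).trans le_sup_left
    · exact (le_biSup W (show k ∈ {k : ℤ | k ≤ -1} by simp only [Set.mem_ofPred_eq]; omega)).trans
        le_sup_right
  have hEN : N.map E = N₁ := by
    simp only [hN, Submodule.map_iSup]
    apply le_antisymm
    · refine iSup₂_le fun k hk => ?_
      rw [hup k hk]
      exact le_biSup W (show k + 1 ∈ {k : ℤ | 1 ≤ k} by simp at hk ⊢; omega)
    · refine iSup₂_le fun k hk => ?_
      have h := hup (k - 1) (by simp at hk; omega)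
      rw [sub_add_cancel] at h
      rw [← h]
      exact le_biSup (fun k => (W k).map E) (show k - 1 ∈ {k : ℤ | 0 ≤ k} by simpa using hk)
  have hFEN' : N'.map (F * E) = N' := by
    simp only [hN', Submodule.map_iSup]
    exact biSup_congr fun k hk => hdown k hk
  have hFEN : N.map (F * E) ≤ N := by
    simp only [hN, Submodule.map_iSup]
    refine iSup₂_mono fun k hk => ?_
    rintro _ ⟨v, hv, rfl⟩
    have := hWF (hWE hv)
    rwa [add_sub_cancel_right] at this
  have hinj : ∀ m ∈ N', (F * E) m = 0 → m = 0 := by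
    intro m hm h0
    have hr : LinearMap.range ((F * E).domRestrict N') = N' := by
      rw [LinearMap.range_domRestrict, hFEN']
    have h := LinearMap.finrank_range_add_finrank_ker ((F * E).domRestrict N')
    rw [hr, Nat.add_eq_left, Submodule.finrank_eq_zero, Submodule.eq_bot_iff] at h
    simpa using h ⟨m, hm⟩ h0
  have hker : LinearMap.ker E ≤ N := by
    intro v hv
    obtain ⟨n, hn, m, hm, rfl⟩ := Submodule.mem_sup.1 (hsum ▸ Submodule.mem_top : v ∈ N ⊔ N')
    have h0 : (F * E) n + (F * E) m = 0 := by
      rw [← map_add, End.mul_apply, LinearMap.mem_ker.1 hv, map_zero]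
    have h1 : (F * E) n ∈ N := hFEN ⟨n, hn, rfl⟩
    have h2 : (F * E) m ∈ N' := hFEN' ▸ ⟨m, hm, rfl⟩
    have h3 : (F * E) m = 0 := by
      refine Submodule.disjoint_def.1 hd _ ?_ h2
      rw [eq_neg_of_add_eq_zero_right h0]
      exact N.neg_mem h1
    rw [hinj m hm h3, add_zero]
    exact hn
  have hsplit : N = W 0 ⊔ N₁ := by
    apply le_antisymm
    · refine iSup₂_le fun k hk => ?_
      rcases (show (0 : ℤ) ≤ k from hk).eq_or_lt with rfl | h
      · exact le_sup_left
      · exact (le_biSup W (show k ∈ {k : ℤ | 1 ≤ k} from h)).trans le_sup_right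
    · refine sup_le (le_biSup W (show (0 : ℤ) ∈ {k : ℤ | 0 ≤ k} from le_refl (0 : ℤ))) ?_
      exact biSup_mono fun k (hk : 1 ≤ k) => (show 0 ≤ k by omega)
  have hd0 : Disjoint (W 0) N₁ := hind.disjoint_biSup (by simp)
  have e1 := LinearMap.finrank_range_add_finrank_ker (E.domRestrict N)
  rw [LinearMap.range_domRestrict, hEN, LinearMap.ker_domRestrict] at e1
  have e2 : finrank ℂ (Submodule.comap N.subtype (LinearMap.ker E)) = finrank ℂ (LinearMap.ker E) :=
    (Submodule.comapSubtypeEquivOfLe hker).finrank_eq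
  have e3 := Submodule.finrank_sup_add_finrank_inf_eq (W 0) N₁
  rw [hd0.eq_bot, finrank_bot, ← hsplit] at e3
  have e4 : W 0 = LinearMap.ker H := by simp [hW]
  rw [← e4]
  rw [e2] at e1
  omega

end GradedOperators

section LieOperators

open Module

section Operators

variable {M : Type*} [AddCommGroup M] [Module ℂ M] [FiniteDimensional ℂ M]

lemma End.isNilpotent_of_commutator {A X : End ℂ M} {c : ℂ} (hc : c ≠ 0)
    (h : A * X - X * A = c • X) : IsNilpotent X := by
  by_contra hX
  have hpow : ∀ n : ℕ, A * X ^ n - X ^ n * A = (n * c) • X ^ n := by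
    intro n
    induction n with
    | zero => simp
    | succ n ih =>
      have : A * X ^ (n + 1) - X ^ (n + 1) * A
          = (A * X ^ n - X ^ n * A) * X + X ^ n * (A * X - X * A) := by
        rw [pow_succ]
        noncomm_ring
      rw [this, ih, h, smul_mul_assoc, mul_smul_comm, ← pow_succ, ← add_smul]
      push_cast
      ring_nf
  set D : End ℂ (End ℂ M) := LinearMap.mulLeft ℂ A - LinearMap.mulRight ℂ A with hD
  have hval : ∀ n : ℕ, D.HasEigenvalue (n * c) := fun n =>
    End.hasEigenvalue_of_hasEigenvector (x := X ^ n)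
      ⟨End.mem_eigenspace_iff.2 (by simpa [hD] using hpow n), fun h0 => hX ⟨n, h0⟩⟩
  refine Set.infinite_of_injective_forall_mem (f := fun n : ℕ => (n * c : ℂ)) ?_ hval
    (End.finite_hasEigenvalue D)
  intro a b hab
  simpa [hc] using hab

lemma End.isSemisimple_of_iSup_eigenspace {ι : Type*} {A : End ℂ M} {f : ι → ℂ}
    (h : ⨆ i, A.eigenspace (f i) = ⊤) : A.IsSemisimple := by
  set s := (End.finite_hasEigenvalue A).toFinset with hs
  refine End.isSemisimple_of_squarefree_aeval_eq_zero
    (p := ∏ μ ∈ s, (Polynomial.X - Polynomial.C μ)) ?_ ?_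
  · exact (Polynomial.separable_prod_X_sub_C_iff'.2 fun _ _ _ _ h => h).squarefree
  · rw [← LinearMap.ker_eq_top, eq_top_iff, ← h]
    refine iSup_le fun i v hv => ?_
    rcases eq_or_ne v 0 with rfl | hv0
    · simp
    have hvec : A.HasEigenvector (f i) v := ⟨hv, hv0⟩
    rw [LinearMap.mem_ker, End.aeval_apply_of_hasEigenvector hvec, Polynomial.eval_prod,
      Finset.prod_eq_zero (i := f i), zero_smul]
    · simpa [hs] using End.hasEigenvalue_of_hasEigenvector hvec
    · simp

end Operators

variable {g : Type*} [LieRing g] [LieAlgebra ℂ g]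

lemma mem_eigenspace_ad_iff {h v : g} {c : ℂ} :
    v ∈ (LieAlgebra.ad ℂ g h).eigenspace c ↔ ⁅h, v⁆ = c • v := by
  rw [End.mem_eigenspace_iff, LieAlgebra.ad_apply]

lemma ad_commutator_of_lie {h x y : g} (hx : ⁅h, x⁆ = y) :
    LieAlgebra.ad ℂ g h * LieAlgebra.ad ℂ g x - LieAlgebra.ad ℂ g x * LieAlgebra.ad ℂ g h
      = LieAlgebra.ad ℂ g y := by
  subst hx
  ext v
  simp

/-- An inner integral grading induces an involutive automorphism by parity. -/
lemma exists_parity_involution {x₀ : g} (h : ⨆ k : ℤ, (LieAlgebra.ad ℂ g x₀).eigenspace (k : ℂ) = ⊤) :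
    ∃ σ : g →ₗ⁅ℂ⁆ g, ∀ k : ℤ, ∀ v : g, ⁅x₀, v⁆ = (k : ℂ) • v → σ v = (-1 : ℂ) ^ k • v := by
  set W : ℤ → Submodule ℂ g := fun k => (LieAlgebra.ad ℂ g x₀).eigenspace (k : ℂ) with hW
  have hind : iSupIndep W := (End.eigenspaces_iSupIndep (LieAlgebra.ad ℂ g x₀)).comp
    (f := fun k : ℤ => (k : ℂ)) Int.cast_injective
  have hcompl : IsCompl (⨆ k ∈ {k : ℤ | Even k}, W k) (⨆ k ∈ {k : ℤ | Odd k}, W k) := by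
    refine ⟨hind.disjoint_biSup_biSup (Set.disjoint_left.2 fun k hk hk' =>
      Int.not_even_iff_odd.2 hk' hk), codisjoint_iff.2 (eq_top_iff.2 (h ▸ iSup_le fun k => ?_))⟩
    rcases Int.even_or_odd k with hk | hk
    · exact (le_biSup W (show k ∈ {k : ℤ | Even k} from hk)).trans le_sup_left
    · exact (le_biSup W (show k ∈ {k : ℤ | Odd k} from hk)).trans le_sup_right
  set s : g →ₗ[ℂ] g := LinearMap.ofIsCompl hcompl (Submodule.subtype _) (-Submodule.subtype _)
    with hs
  have hsv : ∀ k : ℤ, ∀ v ∈ W k, s v = (-1 : ℂ) ^ k • v := by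
    intro k v hv
    rcases Int.even_or_odd k with hk | hk
    · rw [hk.neg_one_zpow, one_smul]
      exact LinearMap.ofIsCompl_apply_left hcompl
        ⟨v, le_biSup W (show k ∈ {k : ℤ | Even k} from hk) hv⟩
    · rw [hk.neg_one_zpow, neg_smul, one_smul]
      exact LinearMap.ofIsCompl_apply_right hcompl
        ⟨v, le_biSup W (show k ∈ {k : ℤ | Odd k} from hk) hv⟩
  have hmem : ∀ v : g, v ∈ ⨆ k, W k := fun v => h ▸ Submodule.mem_top
  refine ⟨{ s with map_lie' := ?_ }, fun k v hv => hsv k v (mem_eigenspace_ad_iff.2 hv)⟩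
  intro x y
  change s ⁅x, y⁆ = ⁅s x, s y⁆
  refine Submodule.iSup_induction W (motive := fun x => s ⁅x, y⁆ = ⁅s x, s y⁆) (hmem x) ?_
    (by simp) (fun a b ha hb => by simp [ha, hb])
  intro k u hu
  refine Submodule.iSup_induction W (motive := fun y => s ⁅u, y⁆ = ⁅s u, s y⁆) (hmem y) ?_
    (by simp) (fun a b ha hb => by simp [ha, hb])
  intro l w hw
  have hb : ⁅u, w⁆ ∈ W (k + l) := by
    simp only [hW, mem_eigenspace_ad_iff] at hu hw ⊢
    rw [leibniz_lie, hu, hw, smul_lie, lie_smul, ← add_smul]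
    push_cast
    rfl
  rw [hsv _ _ hb, hsv _ _ hu, hsv _ _ hw, smul_lie, lie_smul, smul_smul,
    zpow_add₀ (by norm_num)]

lemma isSemisimple_ad_map (φ : g ≃ₗ⁅ℂ⁆ g) {x : g} {ι : Type*} {f : ι → ℂ} [FiniteDimensional ℂ g]
    (h : ⨆ i, (LieAlgebra.ad ℂ g x).eigenspace (f i) = ⊤) :
    (LieAlgebra.ad ℂ g (φ x)).IsSemisimple := by
  refine End.isSemisimple_of_iSup_eigenspace (f := f) ?_
  have : ∀ i, (LieAlgebra.ad ℂ g (φ x)).eigenspace (f i)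
      = ((LieAlgebra.ad ℂ g x).eigenspace (f i)).map φ.toLinearEquiv.toLinearMap := by
    intro i
    ext v
    simp only [Submodule.mem_map, mem_eigenspace_ad_iff]
    constructor
    · intro hv
      refine ⟨φ.symm v, φ.injective ?_, φ.apply_symm_apply v⟩
      change φ ⁅x, φ.symm v⁆ = φ (f i • φ.symm v)
      rw [LieEquiv.map_lie, map_smul, φ.apply_symm_apply, hv]
    · rintro ⟨u, hu, rfl⟩
      change ⁅φ x, φ u⁆ = f i • φ u
      rw [← LieEquiv.map_lie, hu, map_smul]
  simp_rw [this]
  rw [← Submodule.map_iSup, h, Submodule.map_top, LinearEquiv.range]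

lemma isNilpotent_ad_map (φ : g ≃ₗ⁅ℂ⁆ g) {x : g} (h : IsNilpotent (LieAlgebra.ad ℂ g x)) :
    IsNilpotent (LieAlgebra.ad ℂ g (φ x)) := by
  rw [← LieAlgebra.conj_ad_apply]
  exact h.map φ.toLinearEquiv.conjRingEquiv

lemma finrank_ker_ad_map (φ : g ≃ₗ⁅ℂ⁆ g) (x : g) :
    finrank ℂ (LinearMap.ker (LieAlgebra.ad ℂ g (φ x)))
      = finrank ℂ (LinearMap.ker (LieAlgebra.ad ℂ g x)) := by
  have : LinearMap.ker (LieAlgebra.ad ℂ g (φ x))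
      = (LinearMap.ker (LieAlgebra.ad ℂ g x)).map φ.toLinearEquiv.toLinearMap := by
    ext v
    simp only [Submodule.mem_map, LinearMap.mem_ker, LieAlgebra.ad_apply]
    constructor
    · intro hv
      refine ⟨φ.symm v, φ.injective ?_, φ.apply_symm_apply v⟩
      change φ ⁅x, φ.symm v⁆ = φ 0
      rw [LieEquiv.map_lie, φ.apply_symm_apply, hv, map_zero]
    · rintro ⟨u, hu, rfl⟩
      change ⁅φ x, φ u⁆ = 0
      rw [← LieEquiv.map_lie, hu, map_zero]
  rw [this]
  exact LinearEquiv.finrank_map_eq φ.toLinearEquiv _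

/-- The exponential of `ad x`, applied to a vector killed by `(ad x)³`. -/
lemma exists_exp_ad {x : g} (hx : IsNilpotent (LieAlgebra.ad ℂ g x)) :
    ∃ φ : g ≃ₗ⁅ℂ⁆ g, ∀ y, ⁅x, ⁅x, ⁅x, y⁆⁆⁆ = 0 →
      φ y = y + ⁅x, y⁆ + (1 / 2 : ℂ) • ⁅x, ⁅x, y⁆⁆ := by
  let _ : Module ℚ g := Module.compHom g (algebraMap ℚ ℂ)
  let _ : LieAlgebra ℚ g := { lie_smul := fun q x y => lie_smul (algebraMap ℚ ℂ q) x y }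
  have hn : IsNilpotent (LieDerivation.ad ℂ g x).toLinearMap := by
    have := LieDerivation.coe_ad_apply_eq_ad_apply (R := ℂ) (L := g) x
    rw [← this] at hx
    exact hx
  refine ⟨LieDerivation.exp _ hn, fun y hy => ?_⟩
  rw [LieDerivation.exp_map_apply]
  have h := IsNilpotent.exp_smul_eq_sum (a := (LieDerivation.ad ℂ g x).toLinearMap) (m := y)
    (k := 3) (by simpa [pow_succ] using hy) hn
  rw [End.smul_def] at h
  rw [h]
  have h2 : ((2 : ℚ)⁻¹ • ⁅x, ⁅x, y⁆⁆ : g) = (1 / 2 : ℂ) • ⁅x, ⁅x, y⁆⁆ := by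
    change (algebraMap ℚ ℂ 2⁻¹) • ⁅x, ⁅x, y⁆⁆ = _
    norm_num
  simpa [Finset.sum_range_succ, pow_succ, Nat.factorial] using h2

variable [FiniteDimensional ℂ g]

lemma isNilpotent_ad_of_lie {h x : g} {c : ℂ} (hc : c ≠ 0) (hx : ⁅h, x⁆ = c • x) :
    IsNilpotent (LieAlgebra.ad ℂ g x) :=
  End.isNilpotent_of_commutator hc (by rw [ad_commutator_of_lie hx, map_smul])

/-- The Cayley transform of an `sl₂`-triple moves the semisimple element to the sum of the nilpotent
ones. -/
lemma exists_cayley {h e f : g} (he : ⁅h, e⁆ = (2 : ℂ) • e) (hf : ⁅h, f⁆ = (-2 : ℂ) • f)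
    (hef : ⁅e, f⁆ = h) :
    ∃ φ : g ≃ₗ⁅ℂ⁆ g, φ h = e + f ∧ ∀ y, ⁅e, y⁆ = 0 → ⁅f, y⁆ = 0 → φ y = y := by
  have heh : ⁅e, h⁆ = (-2 : ℂ) • e := by rw [← lie_skew, he, neg_smul]
  have hfh : ⁅f, h⁆ = (2 : ℂ) • f := by rw [← lie_skew, hf, neg_smul, neg_neg]
  obtain ⟨φ, hφ⟩ := exists_exp_ad (isNilpotent_ad_of_lie (h := h) (x := (-1 : ℂ) • e) (c := 2)
    (by norm_num) (by rw [lie_smul, he, smul_comm]))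
  obtain ⟨ψ, hψ⟩ := exists_exp_ad (isNilpotent_ad_of_lie (h := h) (x := (1 / 2 : ℂ) • f) (c := -2)
    (by norm_num) (by rw [lie_smul, hf, smul_comm]))
  refine ⟨ψ.trans φ, ?_, fun y hey hfy => ?_⟩
  · have h1 : ψ h = h + f := by
      rw [hψ h (by simp [hfh]), smul_lie, hfh, smul_smul]
      simp
    have h2 : φ (h + f) = e + f := by
      rw [hφ _ (by simp [heh, hef])]
      simp only [smul_lie, lie_smul, lie_add, heh, hef, lie_self, smul_zero, zero_add]
      module
    rw [LieEquiv.trans_apply, h1, h2]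
  · rw [LieEquiv.trans_apply, hψ y (by simp [hfy]), smul_lie, hfy]
    simp only [smul_zero, lie_zero, add_zero]
    rw [hφ y (by simp [hey]), smul_lie, hey]
    simp

/-- The nilpositive element of an even `sl₂`-triple has a centraliser of the same dimension as the
semisimple element. -/
lemma finrank_ker_ad_of_even_triple {h e f : g} (he : ⁅h, e⁆ = (2 : ℂ) • e)
    (hf : ⁅h, f⁆ = (-2 : ℂ) • f) (hef : ⁅e, f⁆ = h)
    (htop : ⨆ k : ℤ, (LieAlgebra.ad ℂ g h).eigenspace (2 * k : ℂ) = ⊤) :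
    finrank ℂ (LinearMap.ker (LieAlgebra.ad ℂ g e))
      = finrank ℂ (LinearMap.ker (LieAlgebra.ad ℂ g h)) :=
  finrank_ker_raise (by rw [ad_commutator_of_lie he, map_smul])
    (by rw [ad_commutator_of_lie hf, map_smul]) (ad_commutator_of_lie hef)
    (isNilpotent_ad_of_lie (by norm_num) he) (isNilpotent_ad_of_lie (by norm_num) hf) htop

end LieOperators

namespace LieRootData

open Module

variable {V : Type*} [NormedAddCommGroup V] [InnerProductSpace ℝ V] {ctx : RootSystemCtx V}
  {g : Type*} [LieRing g] [LieAlgebra ℂ g] (d : LieRootData ctx g)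

lemma coh_neg (v : V) : d.coh (-v) = -d.coh v := by
  have := d.coh_smul (-1) v
  simpa using this

lemma coh_sum {ι : Type*} (s : Finset ι) (f : ι → V) :
    d.coh (∑ i ∈ s, f i) = ∑ i ∈ s, d.coh (f i) :=
  map_sum (AddMonoidHom.mk' d.coh d.coh_add) f s

lemma lie_coh_coh (v w : V) : ⁅d.coh v, d.coh w⁆ = 0 :=
  d.t_abelian _ (d.coh_mem v) _ (d.coh_mem w)

lemma two_smul_not_mem (d : LieRootData ctx g) (γ : V) (hγ : γ ∈ ctx.Δ) : (2 : ℝ) • γ ∉ ctx.Δ := by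
  intro h
  rw [two_smul] at h
  obtain ⟨c, hc, h'⟩ := d.bracket_e_e_root γ hγ γ hγ h
  rw [lie_self] at h'
  exact (smul_ne_zero hc (d.e_ne _ h)) h'.symm

lemma eq_top_of_mem {S : Submodule ℂ g} (hcoh : ∀ v, d.coh v ∈ S) (he : ∀ γ ∈ ctx.Δ, d.e γ ∈ S) :
    S = ⊤ := by
  rw [eq_top_iff, d.span_top, d.t_span]
  refine sup_le (Submodule.span_le.2 ?_) (Submodule.span_le.2 ?_)
  · rintro _ ⟨v, rfl⟩
    exact hcoh v
  · rintro _ ⟨γ, hγ, rfl⟩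
    exact he γ hγ

lemma iSup_eigenspace_ad_coh {ι : Type*} {f : ι → ℂ} {h : V} (h0 : ∃ i, f i = 0)
    (hΔ : ∀ γ ∈ ctx.Δ, ∃ i, f i = (⟪γ, h⟫ : ℝ)) :
    ⨆ i, (LieAlgebra.ad ℂ g (d.coh h)).eigenspace (f i) = ⊤ := by
  refine d.eq_top_of_mem (fun v => ?_) (fun γ hγ => ?_)
  · obtain ⟨i, hi⟩ := h0
    refine Submodule.mem_iSup_of_mem i ?_
    rw [mem_eigenspace_ad_iff, hi, zero_smul, d.lie_coh_coh]
  · obtain ⟨i, hi⟩ := hΔ γ hγ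
    refine Submodule.mem_iSup_of_mem i ?_
    rw [mem_eigenspace_ad_iff, hi, d.bracket_coh_e h γ hγ]

lemma exists_coords (x : g) : ∃ y ∈ d.t, ∃ c : V → ℂ, x = y + ∑ γ ∈ ctx.Δ, c γ • d.e γ := by
  have hx : x ∈ d.t.toSubmodule ⊔ Submodule.span ℂ (d.e '' (ctx.Δ : Set V)) :=
    d.span_top ▸ Submodule.mem_top
  obtain ⟨y, hy, z, hz, rfl⟩ := Submodule.mem_sup.1 hx
  obtain ⟨c, hc, rfl⟩ := (Finsupp.mem_span_image_iff_linearCombination ℂ).1 hz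
  refine ⟨y, hy, c, ?_⟩
  rw [Finsupp.linearCombination_apply, Finsupp.sum_of_support_subset _ _ _ (by simp)]
  exact_mod_cast (Finsupp.mem_supported ℂ c).1 hc

variable [FiniteDimensional ℂ g]

lemma coords_eq_zero {x : g} (hx : x ∈ d.t) {c : V → ℂ} (h : x + ∑ γ ∈ ctx.Δ, c γ • d.e γ = 0) :
    x = 0 ∧ ∀ γ ∈ ctx.Δ, c γ = 0 := by
  let Φ : (d.t.toSubmodule × ({γ // γ ∈ ctx.Δ} → ℂ)) →ₗ[ℂ] g :=
    d.t.toSubmodule.subtype.coprod (Fintype.linearCombination ℂ fun γ => d.e γ.1)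
  have hsurj : Function.Surjective Φ := by
    rw [← LinearMap.range_eq_top, LinearMap.range_coprod, Submodule.range_subtype,
      Fintype.range_linearCombination, d.span_top]
    congr 2
    ext x
    simp
  have hdim : finrank ℂ (d.t.toSubmodule × ({γ // γ ∈ ctx.Δ} → ℂ)) = finrank ℂ g := by
    rw [finrank_prod, d.dim_eq, finrank_fintype_fun_eq_card, Fintype.card_coe]
    rfl
  have hinj := (LinearMap.injective_iff_surjective_of_finrank_eq_finrank hdim).2 hsurj
  have h0 : Φ (⟨x, hx⟩, fun γ => c γ.1) = 0 := by
    rw [← h]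
    simp only [Φ, LinearMap.coprod_apply, Submodule.subtype_apply, Fintype.linearCombination_apply]
    rw [Finset.sum_coe_sort ctx.Δ (fun γ => c γ • d.e γ)]
  have h1 := hinj (h0.trans (map_zero Φ).symm)
  rw [Prod.mk_eq_zero] at h1
  exact ⟨congrArg Subtype.val h1.1, fun γ hγ => congrFun h1.2 ⟨γ, hγ⟩⟩

lemma eq_smul_of_weight {μ : V} (hμ : μ ∈ ctx.Δ) {x : g}
    (hx : ∀ v, ⁅d.coh v, x⁆ = ((⟪μ, v⟫ : ℝ) : ℂ) • x) : ∃ k : ℂ, x = k • d.e μ := by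
  obtain ⟨y, hy, c, rfl⟩ := d.exists_coords x
  have key (v : V) := d.coords_eq_zero (x := ((-⟪μ, v⟫ : ℝ) : ℂ) • y) (d.t.smul_mem _ hy)
    (c := fun γ => c γ * ((⟪γ, v⟫ - ⟪μ, v⟫ : ℝ) : ℂ)) (by
      have h := hx v
      rw [lie_add, d.t_abelian _ (d.coh_mem v) _ hy, zero_add, lie_sum, smul_add,
        Finset.smul_sum, ← sub_eq_zero] at h
      rw [← h]
      have : ∀ γ ∈ ctx.Δ, (c γ * ((⟪γ, v⟫ - ⟪μ, v⟫ : ℝ) : ℂ)) • d.e γ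
          = ⁅d.coh v, c γ • d.e γ⁆ - ((⟪μ, v⟫ : ℝ) : ℂ) • c γ • d.e γ := by
        intro γ hγ
        rw [lie_smul, d.bracket_coh_e v γ hγ]
        push_cast
        module
      rw [Finset.sum_congr rfl this, Finset.sum_sub_distrib]
      push_cast
      module)
  have hy0 : y = 0 := by
    have h := (key μ).1
    rw [smul_eq_zero] at h
    refine h.resolve_left ?_
    have := ctx.inner_self_pos hμ
    exact_mod_cast (by linarith : -⟪μ, μ⟫ < 0).ne
  refine ⟨c μ, ?_⟩
  rw [hy0, zero_add, Finset.sum_eq_single_of_mem μ hμ]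
  intro γ hγ hne
  have h := (key (γ - μ)).2 γ hγ
  rw [← inner_sub_left, mul_eq_zero] at h
  rw [h.resolve_right (by simpa [sub_eq_zero] using hne), zero_smul]

lemma finrank_ker_ad_coh {h : V} (hh : ∀ γ ∈ ctx.Δ, ⟪γ, h⟫ ≠ 0) :
    finrank ℂ (LinearMap.ker (LieAlgebra.ad ℂ g (d.coh h))) = ctx.base.card := by
  rw [← d.rank_eq]
  set A := LieAlgebra.ad ℂ g (d.coh h)
  have hker : d.t.toSubmodule ≤ LinearMap.ker A := fun x hx => d.t_abelian _ (d.coh_mem h) _ hx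
  have hrange : Submodule.span ℂ (d.e '' (ctx.Δ : Set V)) ≤ LinearMap.range A := by
    rw [Submodule.span_le]
    rintro _ ⟨γ, hγ, rfl⟩
    refine ⟨((⟪γ, h⟫ : ℝ) : ℂ)⁻¹ • d.e γ, ?_⟩
    rw [map_smul, LieAlgebra.ad_apply, d.bracket_coh_e h γ hγ, smul_smul, inv_mul_cancel₀,
      one_smul]
    exact_mod_cast hh γ hγ
  have h1 := LinearMap.finrank_range_add_finrank_ker A
  have h2 := Submodule.finrank_mono hker
  have h3 := Submodule.finrank_mono hrange
  have h4 := Submodule.finrank_add_le_finrank_add_finrank d.t.toSubmodule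
    (Submodule.span ℂ (d.e '' (ctx.Δ : Set V)))
  rw [← d.span_top, finrank_top] at h4
  have h5 := d.dim_eq
  change finrank ℂ (LinearMap.ker A) = finrank ℂ d.t.toSubmodule
  change finrank ℂ g = finrank ℂ d.t.toSubmodule + _ at h5
  omega

end LieRootData

namespace LieRootData

open Module RootSystemCtx

section Involution

variable {V : Type*} [NormedAddCommGroup V] [InnerProductSpace ℝ V] [FiniteDimensional ℝ V]
  {ctx : RootSystemCtx V} {g : Type*} [LieRing g] [LieAlgebra ℂ g] (d : LieRootData ctx g)
  {K : Finset V}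

/-- The `(-1)`-eigenspace of the involution attached to the cascade element. -/
noncomputable def oddPart (K : Finset V) : Submodule ℂ g :=
  Submodule.span ℂ (d.e '' {γ | γ ∈ ctx.Δ ∧ ∃ k : ℤ, Odd k ∧ ⟪γ, cascElt K⟫ = (k : ℝ)})

lemma inner_cascElt_of_mem (hK : ctx.IsCascade K) {β : V} (hβ : β ∈ K) :
    ⟪β, cascElt K⟫ = 1 := by
  rw [real_inner_comm, cascElt, hK.inner_sum_smul subset_rfl _ hβ, if_pos hβ]
  exact inv_mul_cancel₀ (ctx.inner_self_pos (hK.mem_root hβ)).ne'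

lemma e_mem_oddPart (hK : ctx.IsCascade K) {β : V} (hβ : β ∈ K) : d.e β ∈ d.oddPart K :=
  Submodule.subset_span ⟨β, ⟨hK.mem_root hβ, 1, odd_one, by
    rw [inner_cascElt_of_mem hK hβ, Int.cast_one]⟩, rfl⟩

lemma e_neg_mem_oddPart (hK : ctx.IsCascade K) {β : V} (hβ : β ∈ K) : d.e (-β) ∈ d.oddPart K :=
  Submodule.subset_span ⟨-β, ⟨ctx.neg_mem _ (hK.mem_root hβ), -1, by decide, by
    rw [inner_neg_left, inner_cascElt_of_mem hK hβ, Int.cast_neg, Int.cast_one]⟩, rfl⟩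

omit [FiniteDimensional ℝ V] in
lemma exists_involution (hcasc : ∀ γ ∈ ctx.Δ, ∃ k : ℤ, ⟪γ, cascElt K⟫ = (k : ℝ)) :
    ∃ σ : g →ₗ⁅ℂ⁆ g, (∀ x, σ (σ x) = x) ∧ (∀ v, σ (d.coh v) = d.coh v) ∧
      (∀ x ∈ d.oddPart K, σ x = -x) ∧ ∀ x, σ x = -x → x ∈ d.oddPart K := by
  obtain ⟨σ, hσ⟩ := exists_parity_involution (x₀ := d.coh (cascElt K))
    (d.iSup_eigenspace_ad_coh ⟨0, Int.cast_zero⟩ fun γ hγ => by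
      obtain ⟨k, hk⟩ := hcasc γ hγ
      exact ⟨k, by rw [hk]; simp⟩)
  have hcoh (v : V) : σ (d.coh v) = d.coh v := by
    have := hσ 0 (d.coh v) (by rw [d.lie_coh_coh]; simp)
    simpa using this
  have he {γ : V} (hγ : γ ∈ ctx.Δ) {k : ℤ} (hk : ⟪γ, cascElt K⟫ = k) :
      σ (d.e γ) = (-1 : ℂ) ^ k • d.e γ := hσ k _ (by rw [d.bracket_coh_e _ γ hγ, hk]; simp)
  have hodd : ∀ x ∈ d.oddPart K, σ x = -x := by
    intro x hx
    induction hx using Submodule.span_induction with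
    | mem x hx =>
      obtain ⟨γ, ⟨hγ, k, hk, hk'⟩, rfl⟩ := hx
      rw [he hγ hk', hk.neg_one_zpow, neg_smul, one_smul]
    | zero => simp
    | add x y _ _ hx hy => rw [map_add, hx, hy, neg_add]
    | smul c x _ hx => rw [map_smul, hx, smul_neg]
  have hsq (x : g) : σ (σ x) = x := by
    have : LinearMap.eqLocus (σ.toLinearMap ∘ₗ σ.toLinearMap) LinearMap.id = ⊤ := by
      refine d.eq_top_of_mem (fun v => ?_) (fun γ hγ => ?_)
      · change σ (σ (d.coh v)) = d.coh v
        rw [hcoh, hcoh]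
      · change σ (σ (d.e γ)) = d.e γ
        obtain ⟨k, hk⟩ := hcasc γ hγ
        rw [he hγ hk, map_smul, he hγ hk, smul_smul, ← mul_zpow]
        simp
    exact (this ▸ Submodule.mem_top :
      x ∈ LinearMap.eqLocus (σ.toLinearMap ∘ₗ σ.toLinearMap) LinearMap.id)
  have hsub (x : g) : x - σ x ∈ d.oddPart K := by
    have : (d.oddPart K).comap (LinearMap.id - σ.toLinearMap) = ⊤ := by
      refine d.eq_top_of_mem (fun v => ?_) (fun γ hγ => ?_)
      · change d.coh v - σ (d.coh v) ∈ d.oddPart K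
        rw [hcoh, sub_self]
        exact zero_mem _
      · change d.e γ - σ (d.e γ) ∈ d.oddPart K
        obtain ⟨k, hk⟩ := hcasc γ hγ
        rw [he hγ hk]
        rcases Int.even_or_odd k with h | h
        · rw [h.neg_one_zpow, one_smul, sub_self]
          exact zero_mem _
        · rw [h.neg_one_zpow, neg_smul, one_smul, sub_neg_eq_add]
          have : d.e γ ∈ d.oddPart K := Submodule.subset_span ⟨γ, ⟨hγ, k, h, hk⟩, rfl⟩
          exact add_mem this this
    exact (this ▸ Submodule.mem_top : x ∈ (d.oddPart K).comap (LinearMap.id - σ.toLinearMap))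
  refine ⟨σ, hsq, hcoh, hodd, fun x hx => ?_⟩
  have h := Submodule.smul_mem _ (1 / 2 : ℂ) (hsub x)
  rw [hx, sub_neg_eq_add, ← two_smul ℂ, smul_smul] at h
  simpa using h

variable [FiniteDimensional ℂ g]

omit [FiniteDimensional ℝ V] [FiniteDimensional ℂ g] in
lemma exists_triple {β : V} (hβ : β ∈ ctx.Δ) : ∃ c : ℂ,
    ⁅((2 / ⟪β, β⟫ : ℝ) : ℂ) • d.coh β, d.e β⁆ = (2 : ℂ) • d.e β ∧
    ⁅((2 / ⟪β, β⟫ : ℝ) : ℂ) • d.coh β, c • d.e (-β)⁆ = (-2 : ℂ) • c • d.e (-β) ∧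
    ⁅d.e β, c • d.e (-β)⁆ = ((2 / ⟪β, β⟫ : ℝ) : ℂ) • d.coh β := by
  obtain ⟨k, hk, h⟩ := d.bracket_e_e_neg β hβ
  have hb : ((⟪β, β⟫ : ℝ) : ℂ) ≠ 0 := by exact_mod_cast (ctx.inner_self_pos hβ).ne'
  refine ⟨((2 / ⟪β, β⟫ : ℝ) : ℂ) * k⁻¹, ?_, ?_, ?_⟩
  · rw [smul_lie, d.bracket_coh_e _ β hβ, smul_smul]
    push_cast
    rw [div_mul_cancel₀ _ hb]
  · rw [smul_lie, lie_smul, d.bracket_coh_e _ _ (ctx.neg_mem β hβ), inner_neg_left, smul_smul,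
      smul_smul, smul_smul]
    congr 1
    push_cast
    field_simp
  · rw [lie_smul, h, smul_smul, mul_assoc, inv_mul_cancel₀ hk, mul_one]

omit [FiniteDimensional ℂ g] in
lemma lie_e_e_of_ne (hK : ctx.IsCascade K) {β β' : V} (hβ : β ∈ K) (hβ' : β' ∈ K) (hne : β ≠ β')
    {s s' : V} (hs : s = β ∨ s = -β) (hs' : s' = β' ∨ s' = -β') : ⁅d.e s, d.e s'⁆ = 0 := by
  have h1 := hK.mem_root hβ
  have h1' := hK.mem_root hβ'
  have hsΔ : s ∈ ctx.Δ := by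
    rcases hs with rfl | rfl
    exacts [h1, ctx.neg_mem _ h1]
  have hsΔ' : s' ∈ ctx.Δ := by
    rcases hs' with rfl | rfl
    exacts [h1', ctx.neg_mem _ h1']
  have horth : ⟪s, s'⟫ = 0 := by
    have := hK.orthogonal hβ hβ' hne
    rcases hs with rfl | rfl <;> rcases hs' with rfl | rfl <;> simp [this]
  refine d.bracket_e_e_zero _ hsΔ _ hsΔ' (fun h => ?_) (fun h => ?_)
  · have ha := hK.add_not_mem hβ hβ' hne
    have hb := hK.sub_not_mem hβ hβ' hne
    rcases hs with rfl | rfl <;> rcases hs' with rfl | rfl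
    · exact ha h
    · exact hb (by rwa [sub_eq_add_neg])
    · exact hb (by simpa [add_comm, sub_eq_add_neg] using ctx.neg_mem _ h)
    · exact ha (by simpa [add_comm] using ctx.neg_mem _ h)
  · rw [eq_neg_of_add_eq_zero_right h, inner_neg_right, neg_eq_zero] at horth
    exact (ctx.inner_self_pos hsΔ).ne' horth

lemma exists_cayley_of_subset (hK : ctx.IsCascade K) (K' : Finset V) (hK' : K' ⊆ K) :
    ∃ C : g ≃ₗ⁅ℂ⁆ g, (∀ β ∈ K', C (d.coh β) ∈ d.oddPart K) ∧
      (∀ v, (∀ β ∈ K', ⟪v, β⟫ = 0) → C (d.coh v) = d.coh v) ∧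
      ∀ β ∈ K, β ∉ K' → C (d.e β) = d.e β ∧ C (d.e (-β)) = d.e (-β) := by
  induction K' using Finset.induction_on with
  | empty => exact ⟨LieEquiv.refl, by simp, fun _ _ => rfl, fun _ _ _ => ⟨rfl, rfl⟩⟩
  | insert b K' hb ih =>
    obtain ⟨C, hC₁, hC₂, hC₃⟩ := ih ((Finset.subset_insert b K').trans hK')
    have hbK : b ∈ K := hK' (Finset.mem_insert_self b K')
    have hbΔ := hK.mem_root hbK
    have hKK : ∀ β ∈ K', β ∈ K := fun β h => hK' (Finset.mem_insert_of_mem h)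
    obtain ⟨c, h₁, h₂, h₃⟩ := d.exists_triple hbΔ
    obtain ⟨φ, hφ, hφ'⟩ := exists_cayley h₁ h₂ h₃
    have hfix (v : V) (hv : ⟪v, b⟫ = 0) : φ (d.coh v) = d.coh v := by
      apply hφ'
      · rw [← lie_skew, d.bracket_coh_e _ _ hbΔ, real_inner_comm, hv]
        simp
      · rw [smul_lie, ← lie_skew, d.bracket_coh_e _ _ (ctx.neg_mem _ hbΔ), inner_neg_left,
          real_inner_comm, hv]
        simp
    have hfixe (β s : V) (hβ : β ∈ K) (hne : β ≠ b) (hs : s = β ∨ s = -β) : φ (d.e s) = d.e s := by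
      apply hφ'
      · exact d.lie_e_e_of_ne hK hbK hβ hne.symm (Or.inl rfl) hs
      · rw [smul_lie, d.lie_e_e_of_ne hK hbK hβ hne.symm (Or.inr rfl) hs, smul_zero]
    refine ⟨φ.trans C, ?_, ?_, ?_⟩
    · intro β hβ
      rw [LieEquiv.trans_apply]
      rcases Finset.mem_insert.1 hβ with rfl | hβ₁
      · have hpos : ((2 / ⟪β, β⟫ : ℝ) : ℂ) ≠ 0 := by
          exact_mod_cast (div_pos two_pos (ctx.inner_self_pos hbΔ)).ne'
        rw [← (d.oddPart K).smul_mem_iff hpos, ← map_smul, ← map_smul, hφ, map_add, map_smul,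
          (hC₃ β hbK hb).1, (hC₃ β hbK hb).2]
        exact add_mem (d.e_mem_oddPart hK hbK)
          (Submodule.smul_mem _ _ (d.e_neg_mem_oddPart hK hbK))
      · rw [hfix β (hK.orthogonal (hKK β hβ₁) hbK (by rintro rfl; exact hb hβ₁))]
        exact hC₁ β hβ₁
    · intro v hv
      rw [LieEquiv.trans_apply, hfix v (hv b (Finset.mem_insert_self b K'))]
      exact hC₂ v fun β hβ => hv β (Finset.mem_insert_of_mem hβ)
    · intro β hβ hβ'
      rw [Finset.mem_insert, not_or] at hβ'
      rw [LieEquiv.trans_apply, LieEquiv.trans_apply, hfixe β _ hβ hβ'.1 (Or.inl rfl),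
        hfixe β _ hβ hβ'.1 (Or.inr rfl)]
      exact hC₃ β hβ hβ'.2

lemma exists_conjugate_involution (hK : ctx.IsCascade K)
    (hcasc : ∀ γ ∈ ctx.Δ, ∃ k : ℤ, ⟪γ, cascElt K⟫ = (k : ℝ)) :
    ∃ (C : g ≃ₗ⁅ℂ⁆ g) (τ : g →ₗ⁅ℂ⁆ g), (∀ x, τ (τ x) = x) ∧
      (∀ v, τ (d.coh v) = -d.coh (cascStar K v)) ∧ ∀ x, τ x = -x → C x ∈ d.oddPart K := by
  obtain ⟨σ, hσ, hσ', hodd, hmem⟩ := d.exists_involution hcasc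
  obtain ⟨C, hC, hC', -⟩ := d.exists_cayley_of_subset hK K subset_rfl
  refine ⟨C, C.symm.toLieHom.comp (σ.comp C.toLieHom), ?_, ?_, ?_⟩
  · intro x
    change C.symm (σ (C (C.symm (σ (C x))))) = x
    rw [C.apply_symm_apply, hσ, C.symm_apply_apply]
  · intro v
    change C.symm (σ (C (d.coh v))) = _
    have hK₁ : ∀ β ∈ K, σ (C (d.coh β)) = -C (d.coh β) := fun β hβ => hodd _ (hC β hβ)
    have hp : σ (C (d.coh (v - cascStar K v))) = C (d.coh (v - cascStar K v)) := by
      rw [hC', hσ']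
      intro β hβ
      rw [inner_sub_left, hK.inner_cascStar v hβ, sub_self]
    have hs : σ (C (d.coh (v + cascStar K v))) = -C (d.coh (v + cascStar K v)) := by
      rw [add_cascStar, d.coh_sum, map_sum, map_sum, ← Finset.sum_neg_distrib]
      refine Finset.sum_congr rfl fun β hβ => ?_
      rw [d.coh_smul, map_smul, map_smul, hK₁ β hβ, smul_neg]
    rw [sub_eq_add_neg, d.coh_add, d.coh_neg] at hp
    rw [d.coh_add] at hs
    simp only [map_add, map_neg] at hp hs
    apply C.injective
    change C (C.symm (σ (C (d.coh v)))) = C (-d.coh (cascStar K v))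
    rw [C.apply_symm_apply, map_neg]
    have h2 : (2 : ℂ) • σ (C (d.coh v)) = (2 : ℂ) • -C (d.coh (cascStar K v)) := by
      rw [two_smul, two_smul]
      have := congrArg₂ (· + ·) hp hs
      rw [show σ (C (d.coh v)) + σ (C (d.coh v)) = σ (C (d.coh v)) + -σ (C (d.coh (cascStar K v)))
        + (σ (C (d.coh v)) + σ (C (d.coh (cascStar K v)))) by abel, this]
      abel
    exact smul_right_injective g (two_ne_zero (α := ℂ)) h2
  · intro x hx
    apply hmem
    have h : C.symm (σ (C x)) = -x := hx
    rw [← map_neg, ← h, C.apply_symm_apply]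

end Involution

end LieRootData

namespace LieRootData

open Module RootSystemCtx

variable {V : Type*} [NormedAddCommGroup V] [InnerProductSpace ℝ V] [FiniteDimensional ℝ V]
  {ctx : RootSystemCtx V} {g : Type*} [LieRing g] [LieAlgebra ℂ g] [FiniteDimensional ℂ g]
  (d : LieRootData ctx g) {K : Finset V}

lemma cascStar_rho (hK : ctx.IsCascade K) : cascStar K ctx.rho = ctx.rho := by
  rw [← sub_eq_zero]
  refine ext_inner_left ℝ fun v => ?_
  have hv : v ∈ Submodule.span ℝ (ctx.base : Set V) := ctx.span_base ▸ Submodule.mem_top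
  rw [inner_zero_right]
  induction hv using Submodule.span_induction with
  | mem v hv =>
    rw [inner_sub_right, ← hK.inner_cascStar_comm, ctx.inner_rho (hK.cascStar_mem_base hv),
      ctx.inner_rho hv, sub_self]
  | zero => rw [inner_zero_left]
  | add v w _ _ hv hw => rw [inner_add_left, hv, hw, add_zero]
  | smul a v _ hv => rw [inner_smul_left, hv, mul_zero]

lemma exists_rho_coords (hK : ctx.IsCascade K) : ∃ r : V → ℝ,
    (∀ α, r (cascStar K α) = r α) ∧ ∑ α ∈ ctx.base, r α • α = (2 : ℝ) • ctx.rho := by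
  obtain ⟨c, -, hc⟩ := Submodule.mem_span_finset.1
    (ctx.span_base ▸ Submodule.mem_top : ctx.rho ∈ Submodule.span ℝ (ctx.base : Set V))
  refine ⟨fun α => c α + c (cascStar K α), fun α => ?_, ?_⟩
  · simp only [hK.cascStar_cascStar, add_comm]
  · have h : ∑ α ∈ ctx.base, c (cascStar K α) • α = ctx.rho := by
      rw [← cascStar_rho hK, ← hc, map_sum]
      refine Finset.sum_bij' (fun α _ => cascStar K α) (fun α _ => cascStar K α)
        (fun α hα => hK.cascStar_mem_base hα) (fun α hα => hK.cascStar_mem_base hα)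
        (fun α _ => hK.cascStar_cascStar α) (fun α _ => hK.cascStar_cascStar α) (fun α _ => ?_)
      rw [map_smul, hK.cascStar_cascStar]
    simp only [add_smul]
    rw [Finset.sum_add_distrib, h, hc, two_smul]

/-- The nilpositive element of a principal `sl₂`-triple `(2ρ, e, -τ e)` adapted to an involution acting on
the Cartan subalgebra by `-cascStar K`. -/
lemma exists_adapted_triple (hK : ctx.IsCascade K) {τ : g →ₗ⁅ℂ⁆ g} (hτ : ∀ x, τ (τ x) = x)
    (hcoh : ∀ v, τ (d.coh v) = -d.coh (cascStar K v)) :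
    ∃ E : g, ⁅d.coh ((2 : ℝ) • ctx.rho), E⁆ = (2 : ℂ) • E ∧
      ⁅E, -τ E⁆ = d.coh ((2 : ℝ) • ctx.rho) := by
  obtain ⟨r, hr, hrsum⟩ := exists_rho_coords hK
  have hinj : Function.Injective τ := fun x y h => by rw [← hτ x, h, hτ]
  have hweight : ∀ α ∈ ctx.base, ∃ k : ℂ, k ≠ 0 ∧ τ (d.e (cascStar K α)) = k • d.e (-α) := by
    intro α hα
    have hs := ctx.base_mem (hK.cascStar_mem_base hα)
    obtain ⟨k, hk⟩ := d.eq_smul_of_weight (ctx.neg_mem _ (ctx.base_mem hα))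
      (x := τ (d.e (cascStar K α))) (fun v => by
        have : d.coh v = τ (-d.coh (cascStar K v)) := by rw [← hcoh, hτ]
        rw [this, ← LieHom.map_lie, neg_lie, d.bracket_coh_e _ _ hs, hK.inner_cascStar_cascStar,
          ← neg_smul, map_smul, inner_neg_left]
        push_cast
        rfl)
    refine ⟨k, ?_, hk⟩
    rintro rfl
    rw [zero_smul, ← map_zero τ] at hk
    exact d.e_ne _ hs (hinj hk)
  have hq : ∀ α ∈ ctx.base, ∃ q : ℂ, q ≠ 0 ∧ ⁅d.e α, τ (d.e (cascStar K α))⁆ = q • d.coh α := by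
    intro α hα
    obtain ⟨k, hk, h⟩ := hweight α hα
    obtain ⟨c, hc, h'⟩ := d.bracket_e_e_neg α (ctx.base_mem hα)
    exact ⟨k * c, mul_ne_zero hk hc, by rw [h, lie_smul, h', smul_smul]⟩
  choose! q hq0 hq using hq
  have hcoh0 : ∀ α ∈ ctx.base, d.coh α ≠ 0 := fun α hα h =>
    ctx.ne_zero_of_mem (ctx.base_mem hα) (d.coh_inj _ h)
  have hqs : ∀ α ∈ ctx.base, q (cascStar K α) = q α := by
    intro α hα
    have hs := hK.cascStar_mem_base hα
    have h1 := congrArg τ (hq α hα)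
    rw [LieHom.map_lie, hτ, map_smul, hcoh, ← lie_skew] at h1
    have h2 := hq _ hs
    rw [hK.cascStar_cascStar] at h2
    rw [h2, smul_neg, neg_inj] at h1
    exact smul_left_injective ℂ (hcoh0 _ hs) h1
  choose root hroot using fun z : ℂ => IsAlgClosed.exists_pow_nat_eq z two_pos
  set a : V → ℂ := fun α => root (-r α / q α) with ha
  have has : ∀ α ∈ ctx.base, a (cascStar K α) = a α := fun α hα => by
    simp only [ha, hr, hqs α hα]
  set E := ∑ α ∈ ctx.base, a α • d.e α with hE
  have hτE : τ E = ∑ α ∈ ctx.base, a α • τ (d.e (cascStar K α)) := by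
    rw [hE, map_sum]
    refine Finset.sum_bij' (fun α _ => cascStar K α) (fun α _ => cascStar K α)
      (fun α hα => hK.cascStar_mem_base hα) (fun α hα => hK.cascStar_mem_base hα)
      (fun α _ => hK.cascStar_cascStar α) (fun α _ => hK.cascStar_cascStar α) (fun α hα => ?_)
    rw [map_smul, hK.cascStar_cascStar, has α hα]
  refine ⟨E, ?_, ?_⟩
  · rw [hE, lie_sum, Finset.smul_sum]
    refine Finset.sum_congr rfl fun α hα => ?_
    rw [lie_smul, d.bracket_coh_e _ _ (ctx.base_mem hα), inner_smul_right, ctx.inner_rho hα,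
      smul_comm]
    norm_num
  · rw [lie_neg, hτE, hE, sum_lie, ← hrsum, d.coh_sum, ← Finset.sum_neg_distrib]
    refine Finset.sum_congr rfl fun α hα => ?_
    rw [lie_sum, Finset.sum_eq_single_of_mem α hα, smul_lie, lie_smul, hq α hα, smul_smul,
      smul_smul, ← sq, d.coh_smul, ← neg_smul]
    · congr 1
      rw [hroot]
      field_simp [hq0 α hα]
    · intro δ hδ hne
      obtain ⟨k, -, h⟩ := hweight δ hδ
      have h0 : α - δ ∉ ctx.Δ := by
        simpa using ctx.sub_not_mem_of_base hα hδ hne.symm one_pos one_pos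
      rw [h, smul_lie, lie_smul, lie_smul, d.bracket_e_e_zero _ (ctx.base_mem hα) _
        (ctx.neg_mem _ (ctx.base_mem hδ)) (by rwa [← sub_eq_add_neg])
        (by rw [← sub_eq_add_neg, sub_ne_zero]; exact hne.symm)]
      simp

/-- An involution of the Lie algebra acting by `-cascStar K` on the Cartan subalgebra has regular
semisimple and regular nilpotent anti-invariants. -/
lemma exists_regular_anti_invariant (hK : ctx.IsCascade K) {τ : g →ₗ⁅ℂ⁆ g} (hτ : ∀ x, τ (τ x) = x)
    (hcoh : ∀ v, τ (d.coh v) = -d.coh (cascStar K v)) (C : g ≃ₗ⁅ℂ⁆ g) :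
    (∃ x, τ x = -x ∧ Module.End.IsSemisimple (LieAlgebra.ad ℂ g (C x)) ∧
      finrank ℂ (LinearMap.ker (LieAlgebra.ad ℂ g (C x))) = ctx.base.card) ∧
    ∃ y, τ y = -y ∧ IsNilpotent (LieAlgebra.ad ℂ g (C y)) ∧
      finrank ℂ (LinearMap.ker (LieAlgebra.ad ℂ g (C y))) = ctx.base.card := by
  obtain ⟨E, hHE, hEF⟩ := d.exists_adapted_triple hK hτ hcoh
  set H := d.coh ((2 : ℝ) • ctx.rho) with hH
  set F := -τ E with hF
  have hτH : τ H = -H := by rw [hH, hcoh, map_smul, cascStar_rho hK]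
  have hτE : τ E = -F := by rw [hF, neg_neg]
  have hτF : τ F = -E := by rw [hF, map_neg, hτ]
  have hHF : ⁅H, F⁆ = (-2 : ℂ) • F := by
    have := congrArg τ hHE
    rw [LieHom.map_lie, map_smul, hτH, hτE, neg_lie, lie_neg, neg_neg] at this
    rw [this, smul_neg, neg_smul]
  have heven : ∀ γ ∈ ctx.Δ, ∃ k : ℤ, ⟪γ, (2 : ℝ) • ctx.rho⟫ = 2 * k := by
    intro γ hγ
    rcases ctx.mem_closure_or hγ with h | h
    · obtain ⟨k, hk⟩ := ctx.inner_rho_int h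
      exact ⟨k, by rw [inner_smul_right, hk]⟩
    · obtain ⟨k, hk⟩ := ctx.inner_rho_int h
      exact ⟨-k, by rw [inner_smul_right, ← neg_neg γ, inner_neg_left, hk, Int.cast_neg]⟩
  have htop : ⨆ k : ℤ, (LieAlgebra.ad ℂ g H).eigenspace (2 * k : ℂ) = ⊤ :=
    d.iSup_eigenspace_ad_coh ⟨0, by simp⟩ fun γ hγ => by
      obtain ⟨k, hk⟩ := heven γ hγ
      exact ⟨k, by rw [hk]; push_cast; rfl⟩
  have hrank : finrank ℂ (LinearMap.ker (LieAlgebra.ad ℂ g H)) = ctx.base.card := by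
    refine d.finrank_ker_ad_coh fun γ hγ => ?_
    rw [inner_smul_right]
    rcases ctx.pos_or_neg γ hγ with h | h
    · linarith [ctx.one_le_inner_rho h]
    · have := ctx.one_le_inner_rho h
      rw [inner_neg_left] at this
      linarith
  refine ⟨⟨H, hτH, isSemisimple_ad_map C htop, by rw [finrank_ker_ad_map, hrank]⟩, ?_⟩
  have hnF : IsNilpotent (LieAlgebra.ad ℂ g (Complex.I • F)) :=
    isNilpotent_ad_of_lie (h := H) (c := -2) (by norm_num) (by rw [lie_smul, hHF, smul_comm])
  obtain ⟨φ, hφ⟩ := exists_exp_ad hnF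
  have hFE : ⁅F, E⁆ = -H := by rw [← lie_skew, hEF]
  have hFH : ⁅F, H⁆ = (2 : ℂ) • F := by rw [← lie_skew, hHF, neg_smul, neg_neg]
  have hφE : φ E = E - Complex.I • H + F := by
    rw [hφ E (by simp [hFE, hFH])]
    simp only [smul_lie, lie_smul, hFE, hFH, lie_neg, smul_neg, smul_smul]
    rw [show (1 / 2 : ℂ) * (Complex.I * (Complex.I * 2)) = -1 by
      linear_combination Complex.I_mul_I]
    module
  refine ⟨φ E, ?_, ?_, ?_⟩
  · rw [hφE, map_add, map_sub, map_smul, hτH, hτE, hτF]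
    module
  · exact isNilpotent_ad_map C (isNilpotent_ad_map φ (isNilpotent_ad_of_lie two_ne_zero hHE))
  · rw [finrank_ker_ad_map, finrank_ker_ad_map, finrank_ker_ad_of_even_triple hHE hHF hEF htop,
      hrank]

end LieRootData

/-- The `(-1)`-eigenspace `g₁` of the involution `σ_K` contains a regular semisimple element
and a regular nilpotent element of `g`. -/
theorem g1_contains_regular_elements {V : Type*} [NormedAddCommGroup V] [InnerProductSpace ℝ V]
    [FiniteDimensional ℝ V] (ctx : RootSystemCtx V)
    {g : Type*} [LieRing g] [LieAlgebra ℂ g] [FiniteDimensional ℂ g]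
    (d : LieRootData ctx g)
    (K : Finset V) (hK : ctx.IsCascade K)
    (hA : ¬ ∃ p, 1 ≤ p ∧ ctx.IsTypeA (2 * p)) :
    ∀ g1 : Submodule ℂ g,
      g1 = Submodule.span ℂ
        (d.e '' {γ | γ ∈ ctx.Δ ∧ ∃ k : ℤ, Odd k ∧ ⟪γ, cascElt K⟫ = (k : ℝ)}) →
      (∃ x ∈ g1, Module.End.IsSemisimple (LieAlgebra.ad ℂ g x) ∧
        Module.finrank ℂ ↥(LinearMap.ker (LieAlgebra.ad ℂ g x)) = ctx.base.card) ∧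
      (∃ y ∈ g1, IsNilpotent (LieAlgebra.ad ℂ g y) ∧
        Module.finrank ℂ ↥(LinearMap.ker (LieAlgebra.ad ℂ g y)) = ctx.base.card) := by
  rintro g1 rfl
  have hcasc : ∀ γ ∈ ctx.Δ, ∃ k : ℤ, ⟪γ, cascElt K⟫ = (k : ℝ) := fun γ hγ =>
    hK.inner_cascElt_int d.two_smul_not_mem hA hγ
  obtain ⟨C, τ, hτ, hcoh, hmem⟩ := d.exists_conjugate_involution hK hcasc
  obtain ⟨⟨x, hx, hx'⟩, y, hy, hy'⟩ := d.exists_regular_anti_invariant hK hτ hcoh C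
  exact ⟨⟨C x, hmem x hx, hx'⟩, C y, hmem y hy, hy'⟩
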